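/- arXiv:2206.05230 — 2 statements merged into one kernel-verified Lean document; each statement's English description precedes it below -/
import Mathlib

section
/- Let p, m, n ∈ ℕ and define 𝖧(p,m,n) := ∫_{−∞}^{∞} H_p(x) H_m(x) H_n(x) e^{−x²} dx. If p > m+n, or m > n+p, or n > m+p, or p+m+n is odd, then 𝖧(p,m,n) = 0. Otherwise (i.e., when p+m+n is even and the three triangle inequalities hold), 𝖧(p,m,n) = √π · m! n! p! · 2^{(p+m+n)/2} / ( ((m+n−p)/2)! · ((m+p−n)/2)! · ((n+p−m)/2)! ). -/
open MeasureTheory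

/-- Pochhammer symbol `(a)_j` for real `a` and natural `j`. -/
noncomputable def poch (a : ℝ) (j : ℕ) : ℝ := (ascPochhammer ℝ j).eval a

/-- Pochhammer symbol `(a)_j` for integer index, with the convention
`(a)_{-j} = 1/((a-1)(a-2)⋯(a-j))` for `j ≥ 1`. -/
noncomputable def pochZ (a : ℝ) (j : ℤ) : ℝ :=
  if 0 ≤ j then poch a j.toNat
  else (∏ i ∈ Finset.range (-j).toNat, (a - (i + 1)))⁻¹

/-- Factorial of an integer: `j!` for `j ≥ 0` and `0` for `j < 0`
(encoding `1/(negative integer)! = 0` via Lean's division by zero). -/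
noncomputable def ifact (j : ℤ) : ℝ := if 0 ≤ j then (j.toNat.factorial : ℝ) else 0

/-- Generalized hypergeometric sum `ᵣF_s(a; b; z)` (intended for terminating series,
where all terms beyond the termination index vanish). -/
noncomputable def hypSum (a b : List ℝ) (z : ℝ) : ℝ :=
  ∑' j : ℕ, ((a.map fun t => poch t j).prod /
    ((b.map fun t => poch t j).prod * (j.factorial : ℝ))) * z ^ j

/-- Physicists' Hermite polynomial `H_n(x)`. -/
noncomputable def hermiteH (n : ℕ) (x : ℝ) : ℝ :=
  (n.factorial : ℝ) * ∑ k ∈ Finset.range (n / 2 + 1),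
    (-1) ^ k * (2 * x) ^ (n - 2 * k) / ((k.factorial : ℝ) * (n - 2 * k).factorial)

/-- The integral `𝖧(p,m,n)` of a product of three Hermite polynomials against `e^{-x²}`. -/
noncomputable def Hint3 (p m n : ℕ) : ℝ :=
  ∫ x : ℝ, hermiteH p x * hermiteH m x * hermiteH n x * Real.exp (-x ^ 2)

open scoped Nat

/-- The `k`-th summand of `H_n(x) / n!`, extended by zero to all `k`. -/
noncomputable def hermiteTerm (n k : ℕ) (x : ℝ) : ℝ :=
  if 2 * k ≤ n then (-1) ^ k * (2 * x) ^ (n - 2 * k) / ((k ! : ℝ) * (n - 2 * k)!) else 0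

lemma hermiteH_eq_sum_hermiteTerm {n N : ℕ} (h : n < 2 * N) (x : ℝ) :
    hermiteH n x = (n ! : ℝ) * ∑ k ∈ Finset.range N, hermiteTerm n k x := by
  have hsub : Finset.range (n / 2 + 1) ⊆ Finset.range N := by
    intro k
    simp only [Finset.mem_range]
    omega
  rw [hermiteH, ← Finset.sum_subset hsub]
  · congr 1
    refine Finset.sum_congr rfl fun k hk => ?_
    rw [hermiteTerm, if_pos (by simp only [Finset.mem_range] at hk; omega)]
  · intro k _ hk
    rw [hermiteTerm, if_neg (by simp only [Finset.mem_range] at hk; omega)]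

lemma hermiteTerm_add_two_zero (n : ℕ) (x : ℝ) :
    ((n : ℝ) + 2) * hermiteTerm (n + 2) 0 x = 2 * x * hermiteTerm (n + 1) 0 x := by
  simp only [hermiteTerm, Nat.mul_zero, Nat.zero_le, if_true, Nat.sub_zero, Nat.factorial_succ]
  push_cast
  field_simp
  ring

lemma hermiteTerm_add_two_succ (n k : ℕ) (x : ℝ) :
    ((n : ℝ) + 2) * hermiteTerm (n + 2) (k + 1) x =
      2 * x * hermiteTerm (n + 1) (k + 1) x - 2 * hermiteTerm n k x := by
  rcases lt_trichotomy n (2 * k) with h | rfl | h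
  · rw [hermiteTerm, hermiteTerm, hermiteTerm, if_neg (by omega), if_neg (by omega),
      if_neg (by omega)]
    ring
  · rw [hermiteTerm, hermiteTerm, hermiteTerm, if_pos (by omega), if_neg (by omega),
      if_pos le_rfl]
    simp only [Nat.mul_add, Nat.mul_one, Nat.sub_self, Nat.factorial_succ]
    push_cast
    field_simp
    ring
  · obtain ⟨j, rfl⟩ := Nat.exists_eq_add_of_lt h
    rw [hermiteTerm, hermiteTerm, hermiteTerm, if_pos (by omega), if_pos (by omega),
      if_pos (by omega), show 2 * k + j + 1 + 2 - 2 * (k + 1) = j + 1 by omega,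
      show 2 * k + j + 1 + 1 - 2 * (k + 1) = j by omega,
      show 2 * k + j + 1 - 2 * k = j + 1 by omega]
    simp only [Nat.factorial_succ]
    push_cast
    field_simp
    ring

lemma hasDerivAt_hermiteTerm (n k : ℕ) (x : ℝ) :
    HasDerivAt (hermiteTerm (n + 1) k) (2 * hermiteTerm n k x) x := by
  rcases lt_trichotomy (n + 1) (2 * k) with h | h | h
  · have hf : hermiteTerm (n + 1) k = fun _ => 0 := by
      funext y
      rw [hermiteTerm, if_neg (by omega)]
    rw [hf, hermiteTerm, if_neg (by omega), mul_zero]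
    exact hasDerivAt_const x 0
  · have hf : hermiteTerm (n + 1) k = fun _ => (-1) ^ k / (k ! : ℝ) := by
      funext y
      rw [hermiteTerm, if_pos h.ge, h]
      simp
    rw [hf, hermiteTerm, if_neg (by omega), mul_zero]
    exact hasDerivAt_const x _
  · obtain ⟨j, rfl⟩ := Nat.exists_eq_add_of_le (Nat.lt_succ_iff.mp h)
    have hf : hermiteTerm (2 * k + j + 1) k =
        fun y => (-1) ^ k * (2 * y) ^ (j + 1) / ((k ! : ℝ) * (j + 1)!) := by
      funext y
      rw [hermiteTerm, if_pos (by omega), show 2 * k + j + 1 - 2 * k = j + 1 by omega]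
    rw [hf, hermiteTerm, if_pos (by omega), show 2 * k + j - 2 * k = j by omega]
    refine (((((hasDerivAt_id x).const_mul 2).pow (j + 1)).const_mul
      ((-1) ^ k)).div_const ((k ! : ℝ) * (j + 1)!)).congr_deriv ?_
    simp only [Nat.factorial_succ, id, Nat.add_sub_cancel]
    push_cast
    field_simp

lemma hermiteH_zero (x : ℝ) : hermiteH 0 x = 1 := by
  simp [hermiteH]

lemma hermiteH_succ (n : ℕ) (x : ℝ) :
    hermiteH (n + 1) x = 2 * x * hermiteH n x - 2 * n * hermiteH (n - 1) x := by
  cases n with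
  | zero => simp [hermiteH]
  | succ n =>
    rw [hermiteH_eq_sum_hermiteTerm (show n + 1 + 1 < 2 * (n + 1 + 1) by omega),
      hermiteH_eq_sum_hermiteTerm (show n + 1 < 2 * (n + 1 + 1) by omega), Nat.add_sub_cancel,
      hermiteH_eq_sum_hermiteTerm (show n < 2 * (n + 1) by omega), Finset.sum_range_succ',
      Finset.sum_range_succ' _ (n + 1)]
    have hs : ((n : ℝ) + 2) * ∑ k ∈ Finset.range (n + 1), hermiteTerm (n + 2) (k + 1) x =
        2 * x * ∑ k ∈ Finset.range (n + 1), hermiteTerm (n + 1) (k + 1) x -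
          2 * ∑ k ∈ Finset.range (n + 1), hermiteTerm n k x := by
      simp only [Finset.mul_sum, ← Finset.sum_sub_distrib, hermiteTerm_add_two_succ]
    have h0 := hermiteTerm_add_two_zero n x
    simp only [Nat.factorial_succ]
    push_cast
    linear_combination ((n : ℝ) + 1) * n ! * (hs + h0)

lemma hasDerivAt_hermiteH (n : ℕ) (x : ℝ) :
    HasDerivAt (hermiteH n) (2 * n * hermiteH (n - 1) x) x := by
  cases n with
  | zero =>
    rw [show hermiteH 0 = fun _ => 1 from funext hermiteH_zero]
    simpa using hasDerivAt_const x (1 : ℝ)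
  | succ n =>
    rw [show hermiteH (n + 1) = fun y => ((n + 1)! : ℝ) *
        ∑ k ∈ Finset.range (n + 1), hermiteTerm (n + 1) k y from
      funext (hermiteH_eq_sum_hermiteTerm (by omega)), Nat.add_sub_cancel,
      hermiteH_eq_sum_hermiteTerm (show n < 2 * (n + 1) by omega)]
    refine ((HasDerivAt.fun_sum fun k _ => hasDerivAt_hermiteTerm n k x).const_mul
      ((n + 1)! : ℝ)).congr_deriv ?_
    rw [← Finset.mul_sum, Nat.factorial_succ]
    push_cast
    ring

lemma exists_polynomial_eval_eq_hermiteH (n : ℕ) :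
    ∃ P : Polynomial ℝ, ∀ x, P.eval x = hermiteH n x := by
  refine ⟨Polynomial.C (n ! : ℝ) * ∑ k ∈ Finset.range (n / 2 + 1),
    Polynomial.C ((-1) ^ k / ((k ! : ℝ) * (n - 2 * k)!)) *
      (Polynomial.C 2 * Polynomial.X) ^ (n - 2 * k), fun x => ?_⟩
  simp only [hermiteH, Polynomial.eval_mul, Polynomial.eval_C, Polynomial.eval_finsetSum,
    Polynomial.eval_pow, Polynomial.eval_X]
  congr 1
  refine Finset.sum_congr rfl fun k _ => ?_
  ring

lemma integrable_polynomial_mul_exp_neg_sq (P : Polynomial ℝ) :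
    Integrable fun x : ℝ => P.eval x * Real.exp (-x ^ 2) := by
  induction P using Polynomial.induction_on' with
  | add P Q hP hQ => simpa only [Polynomial.eval_add, add_mul] using hP.fun_add hQ
  | monomial n a =>
    have h := (integrable_rpow_mul_exp_neg_mul_sq one_pos
      (show (-1 : ℝ) < n by linarith [(n.cast_nonneg : (0 : ℝ) ≤ n)])).const_mul a
    simpa [mul_assoc] using h

lemma integrable_hermiteH_mul_mul_exp_neg_sq (p m n : ℕ) :
    Integrable fun x : ℝ => hermiteH p x * hermiteH m x * hermiteH n x * Real.exp (-x ^ 2) := by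
  obtain ⟨P, hP⟩ := exists_polynomial_eval_eq_hermiteH p
  obtain ⟨Q, hQ⟩ := exists_polynomial_eval_eq_hermiteH m
  obtain ⟨R, hR⟩ := exists_polynomial_eval_eq_hermiteH n
  simpa only [Polynomial.eval_mul, hP, hQ, hR] using
    integrable_polynomial_mul_exp_neg_sq (P * Q * R)

lemma Hint3_succ (p m n : ℕ) :
    Hint3 (p + 1) m n = 2 * m * Hint3 p (m - 1) n + 2 * n * Hint3 p m (n - 1) := by
  have i₁ := integrable_hermiteH_mul_mul_exp_neg_sq (p + 1) m n
  have i₂ := (integrable_hermiteH_mul_mul_exp_neg_sq p (m - 1) n).const_mul (2 * m : ℝ)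
  have i₃ := (integrable_hermiteH_mul_mul_exp_neg_sq p m (n - 1)).const_mul (2 * n : ℝ)
  have hder (x : ℝ) : HasDerivAt
      (fun x => hermiteH p x * hermiteH m x * hermiteH n x * Real.exp (-x ^ 2))
      (2 * m * (hermiteH p x * hermiteH (m - 1) x * hermiteH n x * Real.exp (-x ^ 2)) +
        2 * n * (hermiteH p x * hermiteH m x * hermiteH (n - 1) x * Real.exp (-x ^ 2)) -
        hermiteH (p + 1) x * hermiteH m x * hermiteH n x * Real.exp (-x ^ 2)) x := by
    refine ((((hasDerivAt_hermiteH p x).mul (hasDerivAt_hermiteH m x)).mul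
      (hasDerivAt_hermiteH n x)).mul ((hasDerivAt_pow 2 x).neg.exp)).congr_deriv ?_
    simp only [hermiteH_succ, Pi.mul_apply, Pi.neg_apply]
    push_cast
    ring
  have h := integral_eq_zero_of_hasDerivAt_of_integrable hder ((i₂.fun_add i₃).sub i₁)
    (integrable_hermiteH_mul_mul_exp_neg_sq p m n)
  rw [integral_sub (i₂.fun_add i₃) i₁, integral_add i₂ i₃, integral_const_mul,
    integral_const_mul] at h
  exact (sub_eq_zero.mp h).symm

lemma Hint3_comm_left (p m n : ℕ) : Hint3 p m n = Hint3 m p n := by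
  simp only [Hint3, mul_comm (hermiteH p _)]

lemma Hint3_zero_zero_zero : Hint3 0 0 0 = √Real.pi := by
  simpa [Hint3, hermiteH_zero] using integral_gaussian 1

lemma Hint3_zero_succ (m n : ℕ) : Hint3 0 (m + 1) n = 2 * n * Hint3 0 m (n - 1) := by
  rw [Hint3_comm_left, Hint3_succ, Hint3_comm_left m 0 (n - 1)]
  simp

lemma Hint3_zero_zero_succ (n : ℕ) : Hint3 0 0 (n + 1) = 0 := by
  have h : Hint3 0 0 (n + 1) = Hint3 (n + 1) 0 0 := by
    simp [Hint3, hermiteH_zero]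
  rw [h, Hint3_succ]
  simp

lemma Hint3_zero_self (n : ℕ) : Hint3 0 n n = √Real.pi * n ! * 2 ^ n := by
  induction n with
  | zero => simp [Hint3_zero_zero_zero]
  | succ n ih =>
    rw [Hint3_zero_succ, Nat.add_sub_cancel, ih, Nat.factorial_succ]
    push_cast
    ring

lemma Hint3_zero_of_ne {m n : ℕ} (h : m ≠ n) : Hint3 0 m n = 0 := by
  induction m generalizing n with
  | zero =>
    obtain ⟨k, rfl⟩ := Nat.exists_eq_succ_of_ne_zero h.symm
    exact Hint3_zero_zero_succ k
  | succ m ih =>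
    rw [Hint3_zero_succ]
    cases n with
    | zero => simp
    | succ n => rw [Nat.add_sub_cancel, ih (by omega), mul_zero]

lemma Hint3_eq_zero {p m n : ℕ} (h : ∀ a b c, p = a + b → m = a + c → n ≠ b + c) :
    Hint3 p m n = 0 := by
  induction p generalizing m n with
  | zero => exact Hint3_zero_of_ne fun e => h 0 0 m rfl (by simp) (by simp [e])
  | succ p ih =>
    have h₁ : (m : ℝ) * Hint3 p (m - 1) n = 0 := by
      cases m with
      | zero => simp
      | succ m =>
        rw [Nat.add_sub_cancel, ih, mul_zero]
        intro a b c h₁ h₂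
        exact h (a + 1) b c (by omega) (by omega)
    have h₂ : (n : ℝ) * Hint3 p m (n - 1) = 0 := by
      cases n with
      | zero => simp
      | succ n =>
        rw [Nat.add_sub_cancel, ih, mul_zero]
        intro a b c h₁ h₂ h₃
        exact h a (b + 1) c (by omega) (by omega) (by omega)
    rw [Hint3_succ]
    linear_combination 2 * h₁ + 2 * h₂

lemma Hint3_mul_factorial (a b c : ℕ) :
    Hint3 (a + b) (a + c) (b + c) * (a ! * b ! * c !) =
      √Real.pi * (a + b)! * (a + c)! * (b + c)! * 2 ^ (a + b + c) := by
  induction hp : a + b generalizing a b with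
  | zero =>
    obtain ⟨rfl, rfl⟩ : a = 0 ∧ b = 0 := by omega
    simp only [zero_add, Hint3_zero_self]
    simp
    ring
  | succ p ih =>
    have h₁ : ((a + c : ℕ) : ℝ) * Hint3 p (a + c - 1) (b + c) * (a ! * b ! * c !) * 2 =
        a * (√Real.pi * p ! * (a + c)! * (b + c)! * 2 ^ (p + 1 + c)) := by
      cases a with
      | zero =>
        cases c with
        | zero => simp
        | succ c =>
          rw [Hint3_eq_zero (by omega)]
          simp
      | succ a =>
        have := ih a b (by omega)
        rw [show a + 1 + c = a + c + 1 by omega, Nat.add_sub_cancel]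
        simp only [Nat.factorial_succ]
        push_cast
        linear_combination 2 * ((a : ℝ) + c + 1) * (a + 1) * this
    have h₂ : ((b + c : ℕ) : ℝ) * Hint3 p (a + c) (b + c - 1) * (a ! * b ! * c !) * 2 =
        b * (√Real.pi * p ! * (a + c)! * (b + c)! * 2 ^ (p + 1 + c)) := by
      cases b with
      | zero =>
        cases c with
        | zero => simp
        | succ c =>
          rw [Hint3_eq_zero (by omega)]
          simp
      | succ b =>
        have := ih a b (by omega)
        rw [show b + 1 + c = b + c + 1 by omega, Nat.add_sub_cancel]
        simp only [Nat.factorial_succ]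
        push_cast
        linear_combination 2 * ((b : ℝ) + c + 1) * (b + 1) * this
    have hab : (a : ℝ) + b = p + 1 := by exact_mod_cast hp
    rw [Hint3_succ, Nat.factorial_succ p]
    push_cast at h₁ h₂ ⊢
    linear_combination h₁ + h₂ +
      (√Real.pi * p ! * (a + c)! * (b + c)! * 2 ^ (p + 1 + c)) * hab

theorem stmt5 (p m n : ℕ) :
    (p > m + n ∨ m > n + p ∨ n > m + p ∨ Odd (p + m + n) → Hint3 p m n = 0) ∧
    (p ≤ m + n → m ≤ n + p → n ≤ m + p → Even (p + m + n) →
      Hint3 p m n =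
        Real.sqrt Real.pi * (m.factorial : ℝ) * n.factorial * p.factorial *
            2 ^ ((p + m + n) / 2) /
          ((((m + n - p) / 2).factorial : ℝ) * ((m + p - n) / 2).factorial *
            ((n + p - m) / 2).factorial)) := by
  constructor
  · intro h
    refine Hint3_eq_zero fun a b c h₁ h₂ h₃ => ?_
    rw [Nat.odd_iff] at h
    omega
  · intro h₁ h₂ h₃ h₄
    obtain ⟨s, hs⟩ := h₄
    obtain ⟨a, b, c, rfl, rfl, rfl⟩ : ∃ a b c, p = a + b ∧ m = a + c ∧ n = b + c :=
      ⟨s - n, s - m, s - p, by omega, by omega, by omega⟩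
    rw [show (a + c + (b + c) - (a + b)) / 2 = c by omega,
      show (a + c + (a + b) - (b + c)) / 2 = a by omega,
      show (b + c + (a + b) - (a + c)) / 2 = b by omega,
      show (a + b + (a + c) + (b + c)) / 2 = a + b + c by omega, eq_div_iff (by positivity)]
    linear_combination Hint3_mul_factorial a b c
end

section
/- (Corrected Rahman linearization formula.) Let m, n ∈ ℕ with n ≥ m, let α, β ∈ ℝ with α, β > −1 and with α−β ∉ ℤ and α+β ∉ ℤ (so that all denominator factors below are nonzero), and let x ∈ ℝ. Then P_m^{(α,β)}(x)·P_n^{(α,β)}(x) = Σ_{k=0}^{2m} 𝖺^{α,β}_{k,n,m}·P_{k+n−m}^{(α,β)}(x), where 𝖺^{α,β}_{k,n,m} := [(α+1)_n(β+1)_n(α+β+1)_{2n−2m}(α+β+1)_{2m}(α+β+1+2n−2m+2k)] / [m!(α+β+1)_m(α+1)_{n−m}(β+1)_{n−m}(α+β+2)_{2n}(α+β+1)] · [(n−m+1)_k(α+β+2n−2m+1)_k(2α+2β+2n+2)_k(−2m)_k(α−β)_k] / [k!(2β+2n−2m+2)_k(α+n−m+1)_k(α+β+2n+2)_k(−α−β−2m)_k]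 · ₉F₈(β+n−m+1/2, (β+n−m+5/2)/2, β+1/2, β+n+1, −α−m, (α+β+k+1)/2+n−m, (α+β+k+2)/2+n−m, −k/2, (1−k)/2; (β+n−m+1/2)/2, n−m+1, 1/2−m, α+β+n+3/2, (β−α−k+1)/2, (β−α−k+2)/2, (k+2)/2+β+n−m, (k+3)/2+β+n−m; 1). -/
open MeasureTheory

/-- Jacobi polynomial `P_n^{(α,β)}(x)`. -/
noncomputable def jacobiP (α β : ℝ) (n : ℕ) (x : ℝ) : ℝ :=
  poch (α + 1) n / n.factorial *
    ∑ j ∈ Finset.range (n + 1),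
      poch (-(n : ℝ)) j * poch ((n : ℝ) + α + β + 1) j /
        (poch (α + 1) j * j.factorial) * ((1 - x) / 2) ^ j

/-- The (corrected) Rahman linearization coefficient `𝖺^{α,β}_{k,n,m}`. -/
noncomputable def aRah (α β : ℝ) (k n m : ℤ) : ℝ :=
  (pochZ (α + 1) n * pochZ (β + 1) n * pochZ (α + β + 1) (2 * n - 2 * m) *
      pochZ (α + β + 1) (2 * m) * (α + β + 1 + 2 * (n : ℝ) - 2 * m + 2 * k)) /
    (ifact m * pochZ (α + β + 1) m * pochZ (α + 1) (n - m) * pochZ (β + 1) (n - m) *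
      pochZ (α + β + 2) (2 * n) * (α + β + 1)) *
  ((pochZ ((n : ℝ) - m + 1) k * pochZ (α + β + 2 * (n : ℝ) - 2 * m + 1) k *
      pochZ (2 * α + 2 * β + 2 * (n : ℝ) + 2) k * pochZ (-2 * (m : ℝ)) k *
      pochZ (α - β) k) /
    (ifact k * pochZ (2 * β + 2 * (n : ℝ) - 2 * m + 2) k *
      pochZ (α + (n : ℝ) - m + 1) k * pochZ (α + β + 2 * (n : ℝ) + 2) k *
      pochZ (-α - β - 2 * (m : ℝ)) k)) *
  hypSum
    [β + (n : ℝ) - m + 1 / 2, (β + (n : ℝ) - m + 5 / 2) / 2, β + 1 / 2, β + (n : ℝ) + 1,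
      -α - (m : ℝ), (α + β + (k : ℝ) + 1) / 2 + (n : ℝ) - m,
      (α + β + (k : ℝ) + 2) / 2 + (n : ℝ) - m, -(k : ℝ) / 2, (1 - (k : ℝ)) / 2]
    [(β + (n : ℝ) - m + 1 / 2) / 2, (n : ℝ) - m + 1, 1 / 2 - (m : ℝ),
      α + β + (n : ℝ) + 3 / 2, (β - α - (k : ℝ) + 1) / 2, (β - α - (k : ℝ) + 2) / 2,
      ((k : ℝ) + 2) / 2 + β + (n : ℝ) - m, ((k : ℝ) + 3) / 2 + β + (n : ℝ) - m]
    1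

/-- The shifted Gamma value `Γ(x + i)`. -/
noncomputable def gammaShift (x : ℝ) (i : ℤ) : ℝ := Real.Gamma (x + i)

/-- The reciprocal factorial `1 / i!`, extended by zero to negative integers. -/
noncomputable def invFact (i : ℤ) : ℝ := (Real.Gamma (i + 1))⁻¹

lemma invFact_eq_mul_succ (i : ℤ) : invFact i = (i + 1) * invFact (i + 1) := by
  unfold invFact
  by_cases h : (i : ℝ) + 1 = 0
  · simp [h, Real.Gamma_zero]
  · push_cast
    rw [Real.Gamma_add_one h, mul_inv, mul_inv_cancel_left₀ h]

lemma invFact_of_neg {i : ℤ} (hi : i < 0) : invFact i = 0 := by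
  obtain ⟨k, rfl⟩ : ∃ k : ℕ, i = -(k : ℤ) - 1 := ⟨(-i - 1).toNat, by omega⟩
  unfold invFact
  have : (((-(k : ℤ) - 1 : ℤ) : ℝ) + 1) = -(k : ℝ) := by push_cast; ring
  rw [this, Real.Gamma_neg_nat_eq_zero, inv_zero]

lemma invFact_natCast (i : ℕ) : invFact i = (i.factorial : ℝ)⁻¹ := by
  unfold invFact
  push_cast
  rw [Real.Gamma_nat_eq_factorial]

lemma gammaShift_ne_zero {x : ℝ} (hx : ∀ z : ℤ, x ≠ z) (i : ℤ) : gammaShift x i ≠ 0 := by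
  refine Real.Gamma_ne_zero fun k hk => hx (-k - i) ?_
  push_cast
  linarith

lemma gammaShift_succ {x : ℝ} (hx : ∀ z : ℤ, x ≠ z) (i : ℤ) :
    gammaShift x (i + 1) = (x + i) * gammaShift x i := by
  have h : x + (i : ℝ) ≠ 0 := fun h => hx (-i) (by push_cast; linarith)
  unfold gammaShift
  rw [← Real.Gamma_add_one h]
  push_cast
  ring_nf

/-- `Γ(x + i) / i!`. -/
noncomputable def gammaFact (x : ℝ) (i : ℤ) : ℝ := gammaShift x i * invFact i

/-- `Γ(x + i) / Γ(y + i)`. -/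
noncomputable def gammaQuot (x y : ℝ) (i : ℤ) : ℝ := gammaShift x i / gammaShift y i

lemma gammaFact_of_neg (x : ℝ) {i : ℤ} (hi : i < 0) : gammaFact x i = 0 := by
  rw [gammaFact, invFact_of_neg hi, mul_zero]

lemma succ_mul_gammaFact_succ {x : ℝ} (hx : ∀ z : ℤ, x ≠ z) (i : ℤ) :
    (i + 1) * gammaFact x (i + 1) = (x + i) * gammaFact x i := by
  rw [gammaFact, gammaFact, gammaShift_succ hx, invFact_eq_mul_succ i]
  ring

lemma gammaFact_common {x : ℝ} (hx : ∀ z : ℤ, x ≠ z) (i : ℤ) :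
    ∃ b : ℝ, gammaFact x (i - 2) = b * ((i - 1) * i * (i + 1)) ∧
      gammaFact x (i - 1) = b * ((x + i - 2) * i * (i + 1)) ∧
      gammaFact x i = b * ((x + i - 2) * (x + i - 1) * (i + 1)) ∧
      gammaFact x (i + 1) = b * ((x + i - 2) * (x + i - 1) * (x + i)) := by
  have g1 := gammaShift_succ hx (i - 2)
  have g2 := gammaShift_succ hx (i - 1)
  have g3 := gammaShift_succ hx i
  have f1 := invFact_eq_mul_succ (i - 2)
  have f2 := invFact_eq_mul_succ (i - 1)
  have f3 := invFact_eq_mul_succ i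
  rw [show i - 2 + 1 = i - 1 by ring] at g1 f1
  rw [show i - 1 + 1 = i by ring] at g2 f2
  push_cast at g1 g2 g3 f1 f2 f3
  refine ⟨gammaShift x (i - 2) * invFact (i + 1), ?_, ?_, ?_, ?_⟩
  · rw [gammaFact, f1, f2, f3]; ring
  · rw [gammaFact, g1, f2, f3]; ring
  · rw [gammaFact, g2, g1, f3]; ring
  · rw [gammaFact, g3, g2, g1]; ring

lemma gammaQuot_succ_mul {x y : ℝ} (hx : ∀ z : ℤ, x ≠ z) (hy : ∀ z : ℤ, y ≠ z) (i : ℤ) :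
    gammaQuot x y (i + 1) * (y + i) = gammaQuot x y i * (x + i) := by
  have h : y + (i : ℝ) ≠ 0 := fun h => hy (-i) (by push_cast; linarith)
  have := gammaShift_ne_zero hy i
  rw [gammaQuot, gammaQuot, gammaShift_succ hx, gammaShift_succ hy]
  field_simp

lemma gammaQuot_common₂ {x y : ℝ} (hx : ∀ z : ℤ, x ≠ z) (hy : ∀ z : ℤ, y ≠ z) (i : ℤ) :
    ∃ c : ℝ, gammaQuot x y (i - 1) = c * (y + i - 1) ∧ gammaQuot x y i = c * (x + i - 1) := by
  have hy0 : y + ((i - 1 : ℤ) : ℝ) ≠ 0 := fun h => hy (-(i - 1)) (by push_cast at *; linarith)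
  have h := gammaQuot_succ_mul hx hy (i - 1)
  rw [show i - 1 + 1 = i by ring] at h
  refine ⟨gammaQuot x y (i - 1) / (y + ((i - 1 : ℤ) : ℝ)), ?_, ?_⟩
  · rw [show y + (i : ℝ) - 1 = y + ((i - 1 : ℤ) : ℝ) by push_cast; ring]
    field_simp
  · rw [show x + (i : ℝ) - 1 = x + ((i - 1 : ℤ) : ℝ) by push_cast; ring, div_mul_eq_mul_div, ← h]
    field_simp

lemma gammaQuot_common₄ {x y : ℝ} (hx : ∀ z : ℤ, x ≠ z) (hy : ∀ z : ℤ, y ≠ z) (j : ℤ) :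
    ∃ c : ℝ, gammaQuot x y (j - 3) = c * ((y + j - 3) * (y + j - 2) * (y + j - 1)) ∧
      gammaQuot x y (j - 2) = c * ((x + j - 3) * (y + j - 2) * (y + j - 1)) ∧
      gammaQuot x y (j - 1) = c * ((x + j - 3) * (x + j - 2) * (y + j - 1)) ∧
      gammaQuot x y j = c * ((x + j - 3) * (x + j - 2) * (x + j - 1)) := by
  have hy' : ∀ k : ℤ, y + k ≠ 0 := fun k h => hy (-k) (by push_cast; linarith)
  have h1 := gammaQuot_succ_mul hx hy (j - 3)
  have h2 := gammaQuot_succ_mul hx hy (j - 2)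
  have h3 := gammaQuot_succ_mul hx hy (j - 1)
  have e1 := hy' (j - 3)
  have e2 := hy' (j - 2)
  have e3 := hy' (j - 1)
  rw [show j - 3 + 1 = j - 2 by ring] at h1
  rw [show j - 2 + 1 = j - 1 by ring] at h2
  rw [show j - 1 + 1 = j by ring] at h3
  push_cast at h1 h2 h3 e1 e2 e3
  rw [← add_sub_assoc] at e1 e2 e3
  rw [← eq_div_iff (by rwa [← add_sub_assoc])] at h1 h2 h3
  refine ⟨gammaQuot x y (j - 3) / ((y + j - 3) * (y + j - 2) * (y + j - 1)), ?_, ?_, ?_, ?_⟩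
  · field_simp
  · rw [h1, ← add_sub_assoc, ← add_sub_assoc]; field_simp
  · rw [h2, h1, ← add_sub_assoc, ← add_sub_assoc, ← add_sub_assoc, ← add_sub_assoc]; field_simp
  · rw [h3, h2, h1]; simp only [← add_sub_assoc]; field_simp

/-- Parameters for which no half-integral coincidences occur. -/
structure GenericPair (α β : ℝ) : Prop where
  two_left : ∀ z : ℤ, 2 * α ≠ z
  two_right : ∀ z : ℤ, 2 * β ≠ z
  two_add : ∀ z : ℤ, 2 * (α + β) ≠ z
  sub : ∀ z : ℤ, α - β ≠ z

/-- The factor of the linearization coefficients depending on `m + n = s` and `N`. -/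
noncomputable def outerFactor (α β : ℝ) (s N : ℤ) : ℝ :=
  gammaFact (α + β + 1) (s - N) * gammaQuot (2 * (α + β + 1)) (α + β + 2) (s + N)

/-- The connection kernel between degrees `N` and `l`. -/
noncomputable def connKernel (α β : ℝ) (N l : ℤ) : ℝ :=
  gammaFact (α - β) (N - l) * gammaQuot (α + β + 1) (2 * β + 2) (N + l)

/-- The multiplier depending on `(s + l) / 2 = R` and `(s - l) / 2 = r`. -/
noncomputable def innerFactor (α β : ℝ) (R r : ℤ) : ℝ :=
  gammaQuot (β + 1) (α + β + 3 / 2) R * gammaQuot (1 / 2) (α + 1) r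

/-- The coefficient of the Gegenbauer generating function with parameter `β + 1/2`. -/
noncomputable def gegen (β : ℝ) (p : ℤ) : ℝ := gammaFact (β + 1 / 2) p

lemma half_ne_intCast (z : ℤ) : (1 / 2 : ℝ) ≠ z := by
  intro h
  have : ((2 * z : ℤ) : ℝ) = ((1 : ℤ) : ℝ) := by push_cast; linarith
  have := Int.cast_injective this
  omega

namespace GenericPair

variable {α β : ℝ}

lemma left_add_one (h : GenericPair α β) (z : ℤ) : α + 1 ≠ z := fun e =>
  h.two_left (2 * (z - 1)) (by push_cast; linarith)

lemma right_add_one (h : GenericPair α β) (z : ℤ) : β + 1 ≠ z := fun e =>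
  h.two_right (2 * (z - 1)) (by push_cast; linarith)

lemma right_add_half (h : GenericPair α β) (z : ℤ) : β + 1 / 2 ≠ z := fun e =>
  h.two_right (2 * z - 1) (by push_cast; linarith)

lemma two_right_add_two (h : GenericPair α β) (z : ℤ) : 2 * β + 2 ≠ z := fun e =>
  h.two_right (z - 2) (by push_cast; linarith)

lemma add_add_one (h : GenericPair α β) (z : ℤ) : α + β + 1 ≠ z := fun e =>
  h.two_add (2 * (z - 1)) (by push_cast; linarith)

lemma add_add_two (h : GenericPair α β) (z : ℤ) : α + β + 2 ≠ z := fun e =>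
  h.two_add (2 * (z - 2)) (by push_cast; linarith)

lemma add_add_three_halves (h : GenericPair α β) (z : ℤ) : α + β + 3 / 2 ≠ z := fun e =>
  h.two_add (2 * z - 3) (by push_cast; linarith)

lemma two_add_add_one (h : GenericPair α β) (z : ℤ) : 2 * (α + β + 1) ≠ z := fun e =>
  h.two_add (z - 2) (by push_cast; linarith)

end GenericPair

lemma summand_relation_poly {α β N R r a i j u v l : ℝ} (ha : a = α + β + 1)
    (hi : i = R + r - N) (hj : j = R + r + N) (hu : u = N - (R - r)) (hv : v = N + (R - r))
    (hl : l = R - r) :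
    N * ((a + i - 1) * (2 * a + j - 2) * (2 * a + j - 1) * (α - β + u - 1) * (a + v - 1) *
            (β + R) * (r - 1 / 2) * (l + β + 1 / 2) +
          i * (2 * a + j - 2) * (α - β + u - 1) * (α - β + u) * (2 * β + 1 + v) *
            (a + R - 1 / 2) * (r - 1 / 2) * l +
          i * (2 * a + j - 2) * u * (a + v - 1) * (a + v) *
            (β + R) * (α + r) * (l + 2 * β + 1) -
          (i - 1) * i * (a + j - 1) * (α - β + u - 1) * (a + v - 1) *
            (a + R - 1 / 2) * (α + r) * (l + β + 1 / 2)) =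
      (N - 1 + a) * (-((a + i - 1) * (a + i) * (2 * a + j - 2) * u * (2 * β + 1 + v) *
            (β + R) * (r - 1 / 2) * (l + β + 1 / 2)) +
          (a + i - 1) * (a + j - 1) * (α - β + u - 1) * (2 * β + v) * (2 * β + 1 + v) *
            (a + R - 1 / 2) * (r - 1 / 2) * l +
          (a + i - 1) * (a + j - 1) * (u - 1) * u * (a + v - 1) *
            (β + R) * (α + r) * (l + 2 * β + 1) +
          i * (a + j - 2) * (a + j - 1) * u * (2 * β + 1 + v) *
            (a + R - 1 / 2) * (α + r) * (l + β + 1 / 2)) := by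
  subst ha hi hj hu hv hl
  ring

/-- The summand of the combination of four linearization coefficients entering the
differential recurrence. -/
noncomputable def bracketSummand (α β ν : ℝ) (N R r : ℤ) : ℝ :=
  (ν + (α + β + 1) + (R + r)) * (outerFactor α β (R + r) N * connKernel α β N (R - r)) *
      innerFactor α β R r * (R - r + β + 1 / 2) +
    (ν - (R - r) + 1) * (outerFactor α β (R + r - 1) N * connKernel α β N (R - r - 1)) *
      innerFactor α β (R - 1) r * (R - r) +
    (ν + (R - r) + 2 * β + 2) * (outerFactor α β (R + r - 1) N * connKernel α β N (R - r + 1)) *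
      innerFactor α β R (r - 1) * (R - r + 2 * β + 1) +
    (ν + 2 - (R + r) - (α + β + 1)) *
      (outerFactor α β (R + r - 2) N * connKernel α β N (R - r)) *
      innerFactor α β (R - 1) (r - 1) * (R - r + β + 1 / 2)

set_option maxRecDepth 8000 in
lemma bracketSummand_relation {α β : ℝ} (h : GenericPair α β) (N R r : ℤ) :
    N * bracketSummand α β N N R r =
      -((N - 1 + (α + β + 1)) *
        bracketSummand α β (-(N - 1) - (α + β + 1)) (N - 1) R r) := by
  obtain ⟨i, hi⟩ : ∃ i, i = R + r - N := ⟨_, rfl⟩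
  obtain ⟨j, hj⟩ : ∃ j, j = R + r + N := ⟨_, rfl⟩
  obtain ⟨u, hu⟩ : ∃ u, u = N - (R - r) := ⟨_, rfl⟩
  obtain ⟨v, hv⟩ : ∃ v, v = N + (R - r) := ⟨_, rfl⟩
  obtain ⟨a, ha⟩ : ∃ a, a = α + β + 1 := ⟨_, rfl⟩
  have ri : (i : ℝ) = R + r - N := by rw [hi]; push_cast; ring
  have rj : (j : ℝ) = R + r + N := by rw [hj]; push_cast; ring
  have ru : (u : ℝ) = N - (R - r) := by rw [hu]; push_cast; ring
  have rv : (v : ℝ) = N + (R - r) := by rw [hv]; push_cast; ring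
  obtain ⟨l, hl⟩ : ∃ l : ℝ, l = R - r := ⟨_, rfl⟩
  have key := summand_relation_poly ha ri rj ru rv hl
  obtain ⟨b, b1, b2, b3, b4⟩ := gammaFact_common h.add_add_one i
  obtain ⟨c, c1, c2, c3, c4⟩ := gammaQuot_common₄ h.two_add_add_one h.add_add_two j
  obtain ⟨d, d1, d2, d3, d4⟩ := gammaFact_common h.sub u
  obtain ⟨e, e1, e2, e3, e4⟩ := gammaQuot_common₄ h.add_add_one h.two_right_add_two (v + 1)
  obtain ⟨f, f1, f2⟩ := gammaQuot_common₂ h.right_add_one h.add_add_three_halves R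
  obtain ⟨g, g1, g2⟩ := gammaQuot_common₂ half_ne_intCast h.left_add_one r
  rw [show v + 1 - 3 = v - 2 by ring] at e1
  rw [show v + 1 - 2 = v - 1 by ring] at e2
  rw [show v + 1 - 1 = v by ring] at e3
  rw [show α + β + 2 = a + 1 by rw [ha]; ring] at c1 c2 c3 c4
  rw [← ha] at b1 b2 b3 b4 c1 c2 c3 c4 e1 e2 e3 e4
  push_cast at e1 e2 e3 e4
  rw [show a + 1 + (j : ℝ) - 3 = a + j - 2 by ring, show a + 1 + (j : ℝ) - 2 = a + j - 1 by ring,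
    show a + 1 + (j : ℝ) - 1 = a + j by ring] at c1
  rw [show a + 1 + (j : ℝ) - 2 = a + j - 1 by ring,
    show a + 1 + (j : ℝ) - 1 = a + j by ring] at c2
  rw [show a + 1 + (j : ℝ) - 1 = a + j by ring] at c3
  rw [show 2 * β + 2 + ((v : ℝ) + 1) - 3 = 2 * β + v by ring,
    show 2 * β + 2 + ((v : ℝ) + 1) - 2 = 2 * β + 1 + v by ring,
    show 2 * β + 2 + ((v : ℝ) + 1) - 1 = 2 * β + 2 + v by ring] at e1
  rw [show a + ((v : ℝ) + 1) - 3 = a + v - 2 by ring,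
    show 2 * β + 2 + ((v : ℝ) + 1) - 2 = 2 * β + 1 + v by ring,
    show 2 * β + 2 + ((v : ℝ) + 1) - 1 = 2 * β + 2 + v by ring] at e2
  rw [show a + ((v : ℝ) + 1) - 3 = a + v - 2 by ring,
    show a + ((v : ℝ) + 1) - 2 = a + v - 1 by ring,
    show 2 * β + 2 + ((v : ℝ) + 1) - 1 = 2 * β + 2 + v by ring] at e3
  rw [show a + ((v : ℝ) + 1) - 3 = a + v - 2 by ring,
    show a + ((v : ℝ) + 1) - 2 = a + v - 1 by ring,
    show a + ((v : ℝ) + 1) - 1 = a + v by ring] at e4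
  rw [show β + 1 + (R : ℝ) - 1 = β + R by ring] at f2
  rw [show α + β + 3 / 2 + (R : ℝ) - 1 = a + R - 1 / 2 by rw [ha]; ring] at f1
  rw [show 1 / 2 + (r : ℝ) - 1 = r - 1 / 2 by ring] at g2
  rw [show α + 1 + (r : ℝ) - 1 = α + r by ring] at g1
  unfold bracketSummand outerFactor connKernel innerFactor
  rw [show R + r - N = i by omega, show R + r + N = j by omega,
    show R + r - 1 - N = i - 1 by omega, show R + r - 1 + N = j - 1 by omega,
    show R + r - 2 - N = i - 2 by omega, show R + r - 2 + N = j - 2 by omega,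
    show R + r - (N - 1) = i + 1 by omega, show R + r + (N - 1) = j - 1 by omega,
    show R + r - 1 - (N - 1) = i by omega, show R + r - 1 + (N - 1) = j - 2 by omega,
    show R + r - 2 - (N - 1) = i - 1 by omega, show R + r - 2 + (N - 1) = j - 3 by omega,
    show N - (R - r) = u by omega, show N + (R - r) = v by omega,
    show N - (R - r - 1) = u + 1 by omega, show N + (R - r - 1) = v - 1 by omega,
    show N - (R - r + 1) = u - 1 by omega, show N + (R - r + 1) = v + 1 by omega,
    show N - 1 - (R - r) = u - 1 by omega, show N - 1 + (R - r) = v - 1 by omega,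
    show N - 1 - (R - r - 1) = u by omega, show N - 1 + (R - r - 1) = v - 2 by omega,
    show N - 1 - (R - r + 1) = u - 2 by omega, show N - 1 + (R - r + 1) = v by omega,
    show α + β + 2 = a + 1 by rw [ha]; ring]
  rw [← ha, ← hl, b1, b2, b3, b4, c1, c2, c3, c4, d1, d2, d3, d4, e1, e2, e3, e4, f1, f2, g1, g2]
  rw [show (N : ℝ) + a + (R + r) = a + j by rw [rj]; ring,
    show (N : ℝ) - l + 1 = u + 1 by rw [ru, hl],
    show (N : ℝ) + l + 2 * β + 2 = 2 * β + 2 + v by rw [rv, hl]; ring,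
    show (N : ℝ) + 2 - (R + r) - a = -(a + i - 2) by rw [ri]; ring,
    show -((N : ℝ) - 1) - a + a + (R + r) = i + 1 by rw [ri]; ring,
    show -((N : ℝ) - 1) - a - l + 1 = -(a + v - 2) by rw [rv, hl]; ring,
    show -((N : ℝ) - 1) - a + l + 2 * β + 2 = -(α - β + u - 2) by rw [ru, hl, ha]; ring,
    show -((N : ℝ) - 1) - a + 2 - (R + r) - a = -(2 * a + j - 3) by rw [rj]; ring]
  revert key
  generalize (N : ℝ) - 1 + a = y28, l + 2 * β + 1 = y27, l + β + 1 / 2 = y26,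
    α + (r : ℝ) = y25, (r : ℝ) - 1 / 2 = y24, β + (R : ℝ) = y23,
    a + (R : ℝ) - 1 / 2 = y22, a + (v : ℝ) = y21, a + (v : ℝ) - 1 = y20,
    a + (v : ℝ) - 2 = y19, 2 * β + 2 + (v : ℝ) = y18, 2 * β + 1 + (v : ℝ) = y17,
    2 * β + (v : ℝ) = y16, (u : ℝ) + 1 = y15, (u : ℝ) - 1 = y14,
    α - β + (u : ℝ) = y13, α - β + (u : ℝ) - 1 = y12, α - β + (u : ℝ) - 2 = y11,
    a + (j : ℝ) = y10, a + (j : ℝ) - 1 = y9, a + (j : ℝ) - 2 = y8,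
    2 * a + (j : ℝ) - 1 = y7, 2 * a + (j : ℝ) - 2 = y6, 2 * a + (j : ℝ) - 3 = y5,
    (i : ℝ) + 1 = y4, (i : ℝ) - 1 = y3, a + (i : ℝ) = y2,
    a + (i : ℝ) - 1 = y1, a + (i : ℝ) - 2 = y0
  intro key
  linear_combination (b * c * d * e * f * g * y4 * y5 * y11 * y19 * y0 * y10 * y15 * y18) * key

/-- The summand of the linearization coefficient of degree `N` in the product of degrees
`m` and `n`. -/
noncomputable def linSummand (α β : ℝ) (m n N r : ℤ) : ℝ :=
  outerFactor α β (m + n) N * connKernel α β N (m + n - 2 * r) *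
    innerFactor α β (m + n - r) r * (m + n - 2 * r + β + 1 / 2) *
    (gegen β (n - r) * gegen β (m - r))

/-- The linearization coefficient, truncated to its first `K` terms. -/
noncomputable def linCoeff (α β : ℝ) (K : ℕ) (m n N : ℤ) : ℝ :=
  ∑ r ∈ Finset.range K, linSummand α β m n N r

lemma gegen_of_neg (β : ℝ) {p : ℤ} (hp : p < 0) : gegen β p = 0 := gammaFact_of_neg _ hp

lemma gegen_mul {α β : ℝ} (h : GenericPair α β) (p : ℤ) :
    p * gegen β p = (β + 1 / 2 + p - 1) * gegen β (p - 1) := by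
  have := succ_mul_gammaFact_succ h.right_add_half (p - 1)
  rw [show p - 1 + 1 = p by ring] at this
  push_cast at this
  rw [sub_add_cancel, ← add_sub_assoc] at this
  exact this

lemma outerFactor_of_lt (α β : ℝ) {s N : ℤ} (hs : s < N) : outerFactor α β s N = 0 := by
  rw [outerFactor, gammaFact_of_neg _ (by omega), zero_mul]

lemma connKernel_of_lt (α β : ℝ) {N l : ℤ} (hl : N < l) : connKernel α β N l = 0 := by
  rw [connKernel, gammaFact_of_neg _ (by omega), zero_mul]

lemma gegen_product_relation {α β : ℝ} (h : GenericPair α β) (ν : ℝ) (p q : ℤ) :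
    (p + q - 1 + β + 1 / 2) * ((ν + 1 - (p - q)) * (gegen β (p - 1) * gegen β q) +
        (ν + 1 + (p - q)) * (gegen β p * gegen β (q - 1))) =
      (ν - (p + q - 1)) * (p + q) * (gegen β p * gegen β q) +
        (ν + (p + q - 1) + 2 * β + 1) * (p + q + 2 * β - 1) *
          (gegen β (p - 1) * gegen β (q - 1)) := by
  have hp := gegen_mul h p
  have hq := gegen_mul h q
  linear_combination ((p + q - 1 - ν) * gegen β q + (2 * β + p + q + ν) * gegen β (q - 1)) * hp +
    ((p + q - 1 - ν) * gegen β p + (2 * β + p + q + ν) * gegen β (p - 1)) * hq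

lemma sum_range_shift {f : ℕ → ℝ} {K : ℕ} (h0 : f 0 = 0) (hK : f K = 0) :
    ∑ r ∈ Finset.range K, f (r + 1) = ∑ r ∈ Finset.range K, f r := by
  have h1 := Finset.sum_range_succ f K
  rw [Finset.sum_range_succ', h0, hK] at h1
  simpa using h1

lemma sum_bracketSummand {α β : ℝ} (h : GenericPair α β) (ν : ℝ) {m : ℤ} (n N : ℤ) {K : ℕ}
    (hK : m < K) :
    (ν + (α + β + 1) + (m + n)) * linCoeff α β K m n N +
        (ν + 1 - (n - m)) * linCoeff α β K m (n - 1) N +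
        (ν + 1 + (n - m)) * linCoeff α β K (m - 1) n N +
        (ν + 2 - (m + n) - (α + β + 1)) * linCoeff α β K (m - 1) (n - 1) N =
      ∑ r ∈ Finset.range K,
        bracketSummand α β ν N (m + n - r) r * (gegen β (n - r) * gegen β (m - r)) := by
  set s := m + n with hs
  let f : ℕ → ℝ := fun r =>
    (ν + (s - 2 * r) + 2 * β + 2) *
      (outerFactor α β (s - 1) N * connKernel α β N (s - 2 * r + 1)) *
      innerFactor α β (s - r) (r - 1) * (s - 2 * r + 2 * β + 1) *
      (gegen β (n - r) * gegen β (m - r))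
  let g : ℕ → ℝ := fun r =>
    (ν + 2 - s - (α + β + 1)) * (outerFactor α β (s - 2) N * connKernel α β N (s - 2 * r)) *
      innerFactor α β (s - r - 1) (r - 1) * (s - 2 * r + β + 1 / 2) *
      (gegen β (n - r) * gegen β (m - r))
  have hf := sum_range_shift (f := f) (K := K)
    (by
      rcases lt_or_ge (s - 1) N with h1 | h1
      · simp [f, outerFactor_of_lt α β h1]
      · simp [f, connKernel_of_lt α β (show N < s + 1 by omega)])
    (by simp [f, gegen_of_neg β (show m - (K : ℤ) < 0 by omega)])
  have hg := sum_range_shift (f := g) (K := K)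
    (by
      rcases lt_or_ge (s - 2) N with h1 | h1
      · simp [g, outerFactor_of_lt α β h1]
      · simp [g, connKernel_of_lt α β (show N < s by omega)])
    (by simp [g, gegen_of_neg β (show m - (K : ℤ) < 0 by omega)])
  have key : ∀ r : ℕ,
      (ν + (α + β + 1) + (m + n)) * linSummand α β m n N r +
        (ν + 1 - (n - m)) * linSummand α β m (n - 1) N r +
        (ν + 1 + (n - m)) * linSummand α β (m - 1) n N r +
        (ν + 2 - (m + n) - (α + β + 1)) * linSummand α β (m - 1) (n - 1) N r =
      bracketSummand α β ν N (m + n - r) r * (gegen β (n - r) * gegen β (m - r)) +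
        (f (r + 1) - f r) + (g (r + 1) - g r) := by
    intro r
    have G := gegen_product_relation h ν (n - r) (m - r)
    simp only [f, g, linSummand, bracketSummand, hs]
    push_cast at G ⊢
    rw [show m + (n - 1) = m + n - 1 by ring, show m - 1 + n = m + n - 1 by ring,
      show m - 1 + (n - 1) = m + n - 2 by ring,
      show m + n - 1 - 2 * (r : ℤ) = m + n - 2 * r - 1 by ring,
      show m + n - 2 - 2 * (r : ℤ) = m + n - 2 * r - 2 by ring,
      show m + n - 1 - (r : ℤ) = m + n - r - 1 by ring,
      show m + n - 2 - (r : ℤ) = m + n - r - 2 by ring,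
      show m + n - (r : ℤ) + r = m + n by ring,
      show m + n - (r : ℤ) - r = m + n - 2 * r by ring,
      show m + n - 2 * ((r : ℤ) + 1) + 1 = m + n - 2 * r - 1 by ring,
      show m + n - 2 * ((r : ℤ) + 1) = m + n - 2 * r - 2 by ring,
      show m + n - ((r : ℤ) + 1) - 1 = m + n - r - 2 by ring,
      show m + n - ((r : ℤ) + 1) = m + n - r - 1 by ring,
      show (r : ℤ) + 1 - 1 = r by ring,
      show n - ((r : ℤ) + 1) = n - r - 1 by ring, show m - ((r : ℤ) + 1) = m - r - 1 by ring,
      show n - 1 - (r : ℤ) = n - r - 1 by ring, show m - 1 - (r : ℤ) = m - r - 1 by ring]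
    linear_combination (outerFactor α β (m + n - 1) N * connKernel α β N (m + n - 2 * r - 1) *
      innerFactor α β (m + n - r - 1) r) * G
  simp only [linCoeff, Finset.mul_sum, ← Finset.sum_add_distrib]
  rw [Finset.sum_congr rfl fun r _ => key r]
  simp only [Finset.sum_add_distrib, Finset.sum_sub_distrib, hf, hg, sub_self, add_zero]
  rfl

lemma linCoeff_bracket_relation {α β : ℝ} (h : GenericPair α β) {m : ℤ} (n N : ℤ) {K : ℕ}
    (hK : m < K) :
    N * ((N + (α + β + 1) + (m + n)) * linCoeff α β K m n N +
        (N + 1 - (n - m)) * linCoeff α β K m (n - 1) N +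
        (N + 1 + (n - m)) * linCoeff α β K (m - 1) n N +
        (N + 2 - (m + n) - (α + β + 1)) * linCoeff α β K (m - 1) (n - 1) N) =
      (N - 1 + (α + β + 1)) *
        ((N - 1 - (m + n)) * linCoeff α β K m n (N - 1) +
        (N - 1 + (α + β + 1) - 1 + (n - m)) * linCoeff α β K m (n - 1) (N - 1) +
        (N - 1 + (α + β + 1) - 1 - (n - m)) * linCoeff α β K (m - 1) n (N - 1) +
        (N - 1 + (m + n) - 2 + 2 * (α + β + 1)) * linCoeff α β K (m - 1) (n - 1) (N - 1)) := by
  have h1 := sum_bracketSummand h N n N hK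
  have h2 := sum_bracketSummand h (-(N - 1) - (α + β + 1)) n (N - 1) hK
  have h3 : N * ∑ r ∈ Finset.range K,
        bracketSummand α β N N (m + n - r) r * (gegen β (n - r) * gegen β (m - r)) =
      -((N - 1 + (α + β + 1)) * ∑ r ∈ Finset.range K,
        bracketSummand α β (-(N - 1) - (α + β + 1)) (N - 1) (m + n - r) r *
          (gegen β (n - r) * gegen β (m - r))) := by
    rw [Finset.mul_sum, Finset.mul_sum, ← Finset.sum_neg_distrib]
    refine Finset.sum_congr rfl fun r _ => ?_
    rw [← mul_assoc, bracketSummand_relation h]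
    ring
  rw [← h1, ← h2] at h3
  linear_combination h3

/-- The summand of the leading linearization coefficient, without its outer factor. -/
noncomputable def topSummand (α β : ℝ) (m n r : ℤ) : ℝ :=
  connKernel α β (m + n) (m + n - 2 * r) * innerFactor α β (m + n - r) r *
    (m + n - 2 * r + β + 1 / 2) * (gegen β (n - r) * gegen β (m - r))

/-- The leading linearization coefficient, without its outer factor. -/
noncomputable def topSum (α β : ℝ) (K : ℕ) (m n : ℤ) : ℝ :=
  ∑ r ∈ Finset.range K, topSummand α β m n r

lemma linCoeff_top (α β : ℝ) (K : ℕ) (m n : ℤ) :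
    linCoeff α β K m n (m + n) = outerFactor α β (m + n) (m + n) * topSum α β K m n := by
  rw [linCoeff, topSum, Finset.mul_sum]
  refine Finset.sum_congr rfl fun r _ => ?_
  rw [linSummand, topSummand]
  push_cast
  ring

lemma topSum_comm (α β : ℝ) (K : ℕ) (m n : ℤ) : topSum α β K m n = topSum α β K n m := by
  refine Finset.sum_congr rfl fun r _ => ?_
  rw [topSummand, topSummand, add_comm m n, add_comm (m : ℝ) n, mul_comm (gegen β (n - r))]

lemma topSummand_poly (α β m n r : ℝ) :
    2 * (2 * (α + β + 1) + 2 * (m + n) + 1) * (m + 1) * (α + 1 + m) *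
          ((α + β + 1 + 2 * (m + n - r)) * (α + β + 1 + 2 * (m + n - r) + 1)) *
          (m + n + 1 - 2 * r + β + 1 / 2) * (β + 1 / 2 + m - r) -
        (α + 1 + (m + n)) * (α + β + 1 + 2 * m) * (α + β + 1 + 2 * m + 1) *
          (2 * (2 * β + 3 + 2 * (m + n - r)) * (α + β + 3 / 2 + (m + n - r))) *
          (m + n - 2 * r + β + 1 / 2) * (m + 1 - r) =
      -(1 / 2) * (2 * (α + β + 1) + 2 * (m + n - r) + 2 * m + 1) *
          ((α - β + 2 * r) * (α - β + 2 * r + 1)) *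
          (2 * (2 * β + 3 + 2 * (m + n - r)) * (α + β + 3 / 2 + (m + n - r))) *
          (n - r) * (m + 1 - r) +
        2 * (2 * (α + β + 1) + 2 * (m + n - r) + 2 * m + 3) *
          ((α + β + 1 + 2 * (m + n - r)) * (α + β + 1 + 2 * (m + n - r) + 1)) *
          r * (α + r) * (β + 1 / 2 + n - r) * (β + 1 / 2 + m - r) := by
  ring

/-- The telescoping certificate for the recurrence of `topSum`. -/
noncomputable def topCertificate (α β : ℝ) (m n r : ℤ) : ℝ :=
  -2 * (2 * (α + β + 1) + 2 * (m + n - r) + 2 * m + 3) * gammaFact (α - β) (2 * r) *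
    gammaQuot (α + β + 1) (2 * β + 2) (2 * (m + n - r) + 2) *
    innerFactor α β (m + n - r + 1) r * r * (α + r) * (β + 1 / 2 + n - r) *
    gegen β (n - r) * gegen β (m + 1 - r)

lemma gammaFact_two_step {x : ℝ} (hx : ∀ z : ℤ, x ≠ z) (i : ℤ) :
    (i + 1) * (i + 2) * gammaFact x (i + 2) = (x + i) * (x + i + 1) * gammaFact x i := by
  have h1 := succ_mul_gammaFact_succ hx i
  have h2 := succ_mul_gammaFact_succ hx (i + 1)
  rw [show i + 1 + 1 = i + 2 by ring] at h2
  push_cast at h2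
  linear_combination (i + 1) * h2 + (x + i + 1) * h1

lemma gammaQuot_two_step {x y : ℝ} (hx : ∀ z : ℤ, x ≠ z) (hy : ∀ z : ℤ, y ≠ z) (i : ℤ) :
    gammaQuot x y (i + 2) * ((y + i) * (y + i + 1)) =
      gammaQuot x y i * ((x + i) * (x + i + 1)) := by
  have h1 := gammaQuot_succ_mul hx hy i
  have h2 := gammaQuot_succ_mul hx hy (i + 1)
  rw [show i + 1 + 1 = i + 2 by ring] at h2
  push_cast at h2
  linear_combination (y + i) * h2 + (x + i + 1) * h1

lemma topSummand_succ {α β : ℝ} (h : GenericPair α β) (m n r : ℤ) :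
    2 * (2 * (α + β + 1) + 2 * (m + n) + 1) * (m + 1) * (α + 1 + m) *
          topSummand α β (m + 1) n r -
        (α + 1 + (m + n)) * (α + β + 1 + 2 * m) * (α + β + 1 + 2 * m + 1) *
          topSummand α β m n r =
      topCertificate α β m n (r + 1) - topCertificate α β m n r := by
  obtain ⟨R, hR⟩ : ∃ R, R = m + n - r := ⟨_, rfl⟩
  have rR : (R : ℝ) = m + n - r := by rw [hR]; push_cast; ring
  have key := topSummand_poly α β m n r
  have hq := gammaQuot_two_step h.add_add_one h.two_right_add_two (2 * R)
  have hv := gammaQuot_succ_mul h.right_add_one h.add_add_three_halves R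
  have hg := gammaQuot_succ_mul half_ne_intCast h.left_add_one r
  have hf := gammaFact_two_step h.sub (2 * r)
  have hw := gegen_mul h (n - r)
  have hx := gegen_mul h (m + 1 - r)
  rw [show m + 1 - r - 1 = m - r by ring] at hx
  have nR : ∀ x : ℝ, (∀ z : ℤ, x ≠ z) → x + R ≠ 0 := fun x hx e => hx (-R) (by
    push_cast; linarith)
  have n1 := nR _ h.add_add_three_halves
  have n2 := nR _ h.right_add_one
  have n3 : 2 * β + 3 + 2 * (R : ℝ) ≠ 0 := fun e => h.two_right (-3 - 2 * R) (by
    push_cast; linarith)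
  have n4 : β + 1 / 2 + (m : ℝ) - r ≠ 0 := fun e => h.right_add_half (r - m) (by
    push_cast; linarith)
  unfold topSummand topCertificate connKernel innerFactor
  rw [show m + 1 + n - (m + 1 + n - 2 * r) = 2 * r by ring,
    show m + 1 + n + (m + 1 + n - 2 * r) = 2 * R + 2 by rw [hR]; ring,
    show m + n - (m + n - 2 * r) = 2 * r by ring,
    show m + n + (m + n - 2 * r) = 2 * R by rw [hR]; ring,
    show m + 1 + n - r = R + 1 by rw [hR]; ring,
    show m + n - (r + 1) = R - 1 by rw [hR]; ring, ← hR,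
    show 2 * (R - 1) + 2 = 2 * R by ring, show R - 1 + 1 = R by ring,
    show 2 * (r + 1) = 2 * r + 2 by ring, show m + 1 - (r + 1) = m - r by ring,
    show n - (r + 1) = n - r - 1 by ring]
  push_cast at hq hf hw hx ⊢
  generalize gammaQuot (α + β + 1) (2 * β + 2) (2 * R + 2) = q' at *
  generalize gammaQuot (α + β + 1) (2 * β + 2) (2 * R) = q at *
  generalize gammaQuot (β + 1) (α + β + 3 / 2) (R + 1) = v' at *
  generalize gammaQuot (β + 1) (α + β + 3 / 2) R = v at *
  generalize gammaQuot (1 / 2) (α + 1) (r + 1) = g' at *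
  generalize gammaQuot (1 / 2) (α + 1) r = g at *
  generalize gammaFact (α - β) (2 * r + 2) = f' at *
  generalize gammaFact (α - β) (2 * r) = f at *
  generalize gegen β (n - r - 1) = w' at *
  generalize gegen β (n - r) = w at *
  generalize gegen β (m + 1 - r) = x at *
  generalize gegen β (m - r) = x' at *
  obtain ⟨k, k1, k2⟩ : ∃ k, q' * v' =
      k * ((α + β + 1 + 2 * R) * (α + β + 1 + 2 * R + 1)) ∧
      q * v = k * (2 * (2 * β + 3 + 2 * R) * (α + β + 3 / 2 + R)) := by
    refine ⟨q * v / (2 * (2 * β + 3 + 2 * R) * (α + β + 3 / 2 + R)), ?_, ?_⟩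
    · rw [div_mul_eq_mul_div, eq_div_iff (by positivity)]
      linear_combination q' * 2 * (2 * β + 3 + 2 * R) * hv + v * hq
    · rw [div_mul_cancel₀ _ (by positivity)]
  obtain ⟨e, e1, e2⟩ : ∃ e, x = e * (β + 1 / 2 + m - r) ∧ x' = e * (m + 1 - r) := by
    refine ⟨x / (β + 1 / 2 + m - r), ?_, ?_⟩
    · rw [div_mul_cancel₀ _ n4]
    · rw [div_mul_eq_mul_div, eq_div_iff n4]
      linear_combination -hx
  have hfg : (r + 1) * (α + (r + 1)) * f' * g' =
      1 / 4 * ((α - β + 2 * r) * (α - β + 2 * r + 1)) * f * g := by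
    linear_combination (r + 1) * f' * hg + g / 4 * hf
  rw [rR] at k1 k2
  subst e1 e2
  linear_combination
    (2 * (2 * (α + β + 1) + 2 * (m + n) + 1) * (m + 1) * (α + 1 + m) * f * g *
        (m + 1 + n - 2 * r + β + 1 / 2) * w * (e * (β + 1 / 2 + m - r)) -
      2 * (2 * (α + β + 1) + 2 * (m + n - r) + 2 * m + 3) * f * g * r * (α + r) *
        (β + 1 / 2 + n - r) * w * (e * (β + 1 / 2 + m - r))) * k1 +
    (-((α + 1 + (m + n)) * (α + β + 1 + 2 * m) * (α + β + 1 + 2 * m + 1) * f * g *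
        (m + n - 2 * r + β + 1 / 2) * w * (e * (m + 1 - r))) +
      2 * (2 * (α + β + 1) + 2 * (m + n - (r + 1)) + 2 * m + 3) * (1 / 4) *
        ((α - β + 2 * r) * (α - β + 2 * r + 1)) * f * g * (n - r) * w *
        (e * (m + 1 - r))) * k2 +
    (2 * (2 * (α + β + 1) + 2 * (m + n - (r + 1)) + 2 * m + 3) *
      (β + 1 / 2 + n - (r + 1)) * w' * (e * (m + 1 - r)) * q * v) * hfg -
    (2 * (2 * (α + β + 1) + 2 * (m + n - (r + 1)) + 2 * m + 3) * (1 / 4) *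
      ((α - β + 2 * r) * (α - β + 2 * r + 1)) * f * g * (e * (m + 1 - r)) * q * v) * hw +
    (f * g * w * e * k) * key

lemma topSum_succ {α β : ℝ} (h : GenericPair α β) {K : ℕ} {m : ℤ} (hK : m + 1 < K) (n : ℤ) :
    2 * (2 * (α + β + 1) + 2 * (m + n) + 1) * (m + 1) * (α + 1 + m) * topSum α β K (m + 1) n =
      (α + 1 + (m + n)) * (α + β + 1 + 2 * m) * (α + β + 1 + 2 * m + 1) * topSum α β K m n := by
  rw [← sub_eq_zero, topSum, topSum, Finset.mul_sum, Finset.mul_sum, ← Finset.sum_sub_distrib,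
    Finset.sum_congr rfl fun (r : ℕ) _ => topSummand_succ h m n r]
  have := Finset.sum_range_sub (fun r : ℕ => topCertificate α β m n r) K
  push_cast at this
  rw [this]
  simp [topCertificate, gegen_of_neg β (show m + 1 - (K : ℤ) < 0 by omega)]

/-- The coefficient of `y ^ i` in the Jacobi polynomial of degree `n`, where `x = 1 - 2 * y`,
up to a factor independent of `i`. -/
noncomputable def jacCoeff (α β : ℝ) (n : ℤ) (i : ℕ) : ℝ :=
  (-1) ^ i * gammaShift (α + β + 1) (n + i) * invFact (n - i) * invFact i / gammaShift (α + 1) i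

/-- The weight relating the normalisation of `jacCoeff` to that of the expansion. -/
noncomputable def jacWeight (α β : ℝ) (N : ℕ) : ℝ := N.factorial / gammaShift (α + β + 1) N

lemma jacWeight_succ {α β : ℝ} (h : GenericPair α β) (N : ℕ) :
    (N + (α + β + 1)) * jacWeight α β (N + 1) = (N + 1) * jacWeight α β N := by
  have h1 := gammaShift_succ h.add_add_one N
  have h2 := gammaShift_ne_zero h.add_add_one N
  have h3 := gammaShift_ne_zero h.add_add_one (N + 1)
  rw [h1] at h3
  have h4 := left_ne_zero_of_mul h3
  rw [jacWeight, jacWeight, Nat.factorial_succ]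
  push_cast at *
  rw [h1]
  field_simp
  ring

/-- The leading coefficient of the degree `s` term of the expansion, up to `topSum`. -/
noncomputable def topWeight (α β : ℝ) (s : ℕ) : ℝ :=
  (2 * s + (α + β + 1)) * jacWeight α β s * outerFactor α β s s * jacCoeff α β s s

lemma topWeight_eq {α β : ℝ} (h : GenericPair α β) (s : ℕ) :
    topWeight α β s = (-1) ^ s * gammaFact (α + β + 1) 0 * invFact 0 *
      gammaShift (2 * (α + β + 1)) (2 * s) /
        (gammaShift (α + β + 1) s * gammaShift (α + 1) s) := by
  have h1 := gammaShift_succ h.add_add_one (2 * s)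
  have h2 := gammaShift_ne_zero h.add_add_one s
  have h3 := gammaShift_ne_zero h.add_add_one (2 * s + 1)
  have h4 := gammaShift_ne_zero h.left_add_one s
  have h5 : gammaShift (α + β + 2) (2 * s) = gammaShift (α + β + 1) (2 * s + 1) := by
    rw [gammaShift, gammaShift]; congr 1; push_cast; ring
  have h6 : (s.factorial : ℝ) ≠ 0 := by positivity
  rw [topWeight, jacWeight, outerFactor, jacCoeff, invFact_natCast, gammaQuot, sub_self,
    show (s : ℤ) + s = 2 * s by ring, h5]
  have h7 : (2 * s + (α + β + 1)) * gammaShift (α + β + 1) (2 * s) =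
    gammaShift (α + β + 1) (2 * s + 1) := by rw [h1]; push_cast; ring
  rw [← h7] at h3 ⊢
  have h8 := left_ne_zero_of_mul h3
  have h9 := right_ne_zero_of_mul h3
  field_simp

lemma topWeight_succ {α β : ℝ} (h : GenericPair α β) (s : ℕ) :
    (α + 1 + s) * topWeight α β (s + 1) =
      -(2 * (2 * (α + β + 1) + 2 * s + 1)) * topWeight α β s := by
  have h1 := gammaShift_succ h.add_add_one s
  have h2 := gammaShift_succ h.left_add_one s
  have h3 := gammaShift_ne_zero h.add_add_one (s + 1)
  have h4 := gammaShift_ne_zero h.left_add_one (s + 1)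
  have h5 := gammaShift_succ h.two_add_add_one (2 * s)
  have h6 := gammaShift_succ h.two_add_add_one (2 * s + 1)
  rw [h1] at h3
  rw [h2] at h4
  rw [topWeight_eq h, topWeight_eq h]
  push_cast
  rw [show 2 * ((s : ℤ) + 1) = 2 * s + 1 + 1 by ring, h6, h5, h1, h2]
  push_cast at *
  have a1 := left_ne_zero_of_mul h3
  have a2 := right_ne_zero_of_mul h3
  have a3 := left_ne_zero_of_mul h4
  have a4 := right_ne_zero_of_mul h4
  field_simp
  ring

lemma jacCoeff_self_succ {α β : ℝ} (h : GenericPair α β) (m : ℕ) :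
    (m + 1) * (α + 1 + m) * jacCoeff α β (m + 1) (m + 1) =
      -((α + β + 1 + 2 * m) * (α + β + 1 + 2 * m + 1)) * jacCoeff α β m m := by
  have h2 := gammaShift_succ h.left_add_one m
  have h4 := gammaShift_ne_zero h.left_add_one (m + 1)
  have h5 := gammaShift_succ h.add_add_one (2 * m)
  have h6 := gammaShift_succ h.add_add_one (2 * m + 1)
  have h7 := invFact_eq_mul_succ m
  rw [h2] at h4
  rw [jacCoeff, jacCoeff]
  push_cast at *
  rw [show (m : ℤ) + 1 + (m + 1) = 2 * m + 1 + 1 by ring, h6, h5, h2, h7, sub_self, sub_self,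
    show (m : ℤ) + m = 2 * m by ring]
  have a3 := left_ne_zero_of_mul h4
  have a4 := right_ne_zero_of_mul h4
  field_simp
  ring

lemma jacCoeff_ne_zero {α β : ℝ} (h : GenericPair α β) {n i : ℕ} (hi : i ≤ n) :
    jacCoeff α β n i ≠ 0 := by
  have h1 := gammaShift_ne_zero h.add_add_one (n + i)
  have h2 := gammaShift_ne_zero h.left_add_one i
  rw [jacCoeff, ← Nat.cast_sub hi, invFact_natCast, invFact_natCast]
  positivity

/-- The constant relating the expansion to the product of two Jacobi polynomials. -/
noncomputable def linConst (α β : ℝ) : ℝ :=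
  topWeight α β 0 * topSummand α β 0 0 0 / (jacCoeff α β 0 0 * jacCoeff α β 0 0)

lemma topWeight_mul_topSum {α β : ℝ} (h : GenericPair α β) {K m n : ℕ} (hK : m + n < K) :
    topWeight α β (m + n) * topSum α β K m n =
      linConst α β * (jacCoeff α β m m * jacCoeff α β n n) := by
  have step : ∀ m n : ℕ, m + 1 < K →
      topWeight α β (m + n) * topSum α β K m n =
        linConst α β * (jacCoeff α β m m * jacCoeff α β n n) →
      topWeight α β (m + 1 + n) * topSum α β K ((m + 1 : ℕ) : ℤ) n =
        linConst α β * (jacCoeff α β ((m + 1 : ℕ) : ℤ) (m + 1) * jacCoeff α β n n) := by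
    intro m n hm ih
    have h1 := topSum_succ h (K := K) (m := m) (by omega) n
    have h2 := topWeight_succ h (m + n)
    have h3 := jacCoeff_self_succ h m
    have n1 : α + 1 + ((m + n : ℕ) : ℝ) ≠ 0 := fun e =>
      h.left_add_one (-(m + n : ℕ)) (by push_cast at *; linarith)
    have n2 : α + 1 + (m : ℝ) ≠ 0 := fun e => h.left_add_one (-m) (by push_cast; linarith)
    have n3 : (m : ℝ) + 1 ≠ 0 := by positivity
    rw [show m + 1 + n = m + n + 1 by ring]
    push_cast at *
    refine mul_left_cancel₀ (mul_ne_zero (mul_ne_zero n1 n2) n3) ?_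
    linear_combination (α + 1 + m) * (m + 1) * topSum α β K (m + 1) n * h2 -
      topWeight α β (m + n) * h1 -
      (α + 1 + (m + n)) * (α + β + 1 + 2 * m) * (α + β + 1 + 2 * m + 1) * ih -
      (α + 1 + (m + n)) * linConst α β * jacCoeff α β n n * h3
  have base : topWeight α β (0 + 0) * topSum α β K (0 : ℕ) (0 : ℕ) =
      linConst α β * (jacCoeff α β (0 : ℕ) 0 * jacCoeff α β (0 : ℕ) 0) := by
    have h0 := jacCoeff_ne_zero h (le_refl 0)
    have : topSum α β K 0 0 = topSummand α β 0 0 0 := by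
      rw [topSum, Finset.sum_eq_single_of_mem 0 (Finset.mem_range.2 (by omega))]
      · rfl
      · intro r _ hr
        rw [topSummand, gegen_of_neg β (show (0 : ℤ) - r < 0 by omega), mul_zero, mul_zero]
    push_cast at *
    rw [this, linConst]
    field_simp
  have left : ∀ m : ℕ, m < K → topWeight α β (m + 0) * topSum α β K m (0 : ℕ) =
      linConst α β * (jacCoeff α β m m * jacCoeff α β (0 : ℕ) 0) := by
    intro m
    induction m with
    | zero => exact fun _ => base
    | succ m ih => exact fun hm => step m 0 hm (ih (by omega))
  induction m with
  | zero =>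
    have := left n (by omega)
    rw [topSum_comm, zero_add, mul_comm (jacCoeff α β (0 : ℕ) 0)]
    simpa using this
  | succ m ih => exact step m n (by omega) (ih (by omega))

open Polynomial

/-- The Jacobi polynomial of degree `n` in `y = (1 - x) / 2`, with coefficients `jacCoeff`. -/
noncomputable def jacPoly (α β : ℝ) (n : ℤ) : ℝ[X] :=
  ∑ i ∈ Finset.range (n + 1).toNat, C (jacCoeff α β n i) * X ^ i

lemma jacCoeff_of_lt (α β : ℝ) {n : ℤ} {i : ℕ} (hi : n < i) : jacCoeff α β n i = 0 := by
  rw [jacCoeff, invFact_of_neg (by omega)]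
  simp

lemma coeff_jacPoly (α β : ℝ) (n : ℤ) (i : ℕ) :
    (jacPoly α β n).coeff i = jacCoeff α β n i := by
  rw [jacPoly, finsetSum_coeff]
  simp only [coeff_C_mul, coeff_X_pow, mul_ite, mul_one, mul_zero]
  rw [Finset.sum_ite_eq, ite_eq_left_iff, Finset.mem_range]
  exact fun hi => (jacCoeff_of_lt α β (by omega)).symm

lemma jacPoly_of_neg (α β : ℝ) {n : ℤ} (hn : n < 0) : jacPoly α β n = 0 := by
  rw [jacPoly, Int.toNat_of_nonpos (by omega), Finset.range_zero, Finset.sum_empty]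

/-- The Euler operator `y d/dy` on polynomials. -/
noncomputable def euler (p : ℝ[X]) : ℝ[X] := X * derivative p

lemma coeff_euler (p : ℝ[X]) (i : ℕ) : (euler p).coeff i = i * p.coeff i := by
  rw [euler]
  cases i with
  | zero => simp
  | succ i =>
    rw [coeff_X_mul, coeff_derivative]
    push_cast
    ring

lemma euler_add (p q : ℝ[X]) : euler (p + q) = euler p + euler q := by
  rw [euler, derivative_add, mul_add, euler, euler]

lemma euler_mul (p q : ℝ[X]) : euler (p * q) = euler p * q + p * euler q := by
  rw [euler, derivative_mul, euler, euler]
  ring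

lemma euler_C_mul (c : ℝ) (p : ℝ[X]) : euler (C c * p) = C c * euler p := by
  rw [euler, derivative_C_mul, euler]
  ring

lemma euler_sum {ι : Type*} (s : Finset ι) (f : ι → ℝ[X]) :
    euler (∑ i ∈ s, f i) = ∑ i ∈ s, euler (f i) := by
  simp only [euler, derivative_sum, Finset.mul_sum]

lemma euler_jacPoly {α β : ℝ} (h : GenericPair α β) (n : ℤ) :
    euler (jacPoly α β n + jacPoly α β (n - 1)) =
      C (n : ℝ) * jacPoly α β n - C (n - 1 + (α + β + 1)) * jacPoly α β (n - 1) := by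
  ext i
  have h1 := gammaShift_succ h.add_add_one (n - 1 + i)
  have h2 := invFact_eq_mul_succ (n - 1 - i)
  rw [show n - 1 + (i : ℤ) + 1 = n + i by ring] at h1
  rw [show n - 1 - (i : ℤ) + 1 = n - i by ring] at h2
  rw [coeff_euler, coeff_sub, coeff_C_mul, coeff_C_mul, coeff_add, coeff_jacPoly, coeff_jacPoly,
    jacCoeff, jacCoeff, h1, h2]
  push_cast
  ring

/-- The relation satisfied by products of Jacobi polynomials, as a property of a family `D`. -/
def EulerRelation (α β : ℝ) (D : ℤ → ℤ → ℝ[X]) (m n : ℤ) : Prop :=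
  euler (D m n + D m (n - 1) + D (m - 1) n + D (m - 1) (n - 1)) =
    C (m + n : ℝ) * D m n + C (1 - (α + β + 1) - (n - m)) * D m (n - 1) +
      C (1 - (α + β + 1) + (n - m)) * D (m - 1) n -
      C (m + n - 2 + 2 * (α + β + 1)) * D (m - 1) (n - 1)

lemma eulerRelation_mul {α β : ℝ} (h : GenericPair α β) (m n : ℤ) :
    EulerRelation α β (fun m n => jacPoly α β m * jacPoly α β n) m n := by
  have h1 := euler_jacPoly h m
  have h2 := euler_jacPoly h n
  have h3 := euler_mul (jacPoly α β m + jacPoly α β (m - 1)) (jacPoly α β n + jacPoly α β (n - 1))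
  rw [h1, h2] at h3
  rw [EulerRelation]
  simp only [C_add, C_sub, C_mul, C_1, C_ofNat] at *
  rw [show ∀ a b c d : ℝ[X], a * b + a * d + c * b + c * d = (a + c) * (b + d) by
    intros; ring, h3]
  ring

/-- The candidate expansion of a product of two Jacobi polynomials. -/
noncomputable def linExpansion (α β : ℝ) (K : ℕ) (m n : ℤ) : ℝ[X] :=
  ∑ N ∈ Finset.range K,
    C ((2 * N + (α + β + 1)) * jacWeight α β N * linCoeff α β K m n N) * jacPoly α β N

lemma linCoeff_of_lt (α β : ℝ) (K : ℕ) {m n N : ℤ} (hN : m + n < N) :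
    linCoeff α β K m n N = 0 :=
  Finset.sum_eq_zero fun r _ => by rw [linSummand, outerFactor_of_lt α β hN]; ring

lemma eulerRelation_linExpansion {α β : ℝ} (h : GenericPair α β) {K : ℕ} {m n : ℤ} (hm : m < K)
    (hmn : m + n < K) : EulerRelation α β (linExpansion α β K) m n := by
  let e : ℤ → ℝ := fun N => linCoeff α β K m n N + linCoeff α β K m (n - 1) N +
    linCoeff α β K (m - 1) n N + linCoeff α β K (m - 1) (n - 1) N
  let f : ℤ → ℝ := fun N => (m + n) * linCoeff α β K m n N +
    (1 - (α + β + 1) - (n - m)) * linCoeff α β K m (n - 1) N +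
    (1 - (α + β + 1) + (n - m)) * linCoeff α β K (m - 1) n N -
    (m + n - 2 + 2 * (α + β + 1)) * linCoeff α β K (m - 1) (n - 1) N
  let E : ℕ → ℝ := fun N => jacWeight α β N * ((N + (α + β + 1)) * e N + f N)
  have hE : ∀ N : ℕ, E (N + 1) = jacWeight α β N * (N * e N - f N) := by
    intro N
    have h1 := linCoeff_bracket_relation h n (N + 1) hm
    have h2 := jacWeight_succ h N
    have h3 : (N : ℝ) + 1 ≠ 0 := by positivity
    simp only [E, e, f]
    rw [show (N : ℤ) + 1 - 1 = N by ring] at h1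
    push_cast at *
    refine mul_left_cancel₀ h3 ?_
    linear_combination jacWeight α β (N + 1) * h1 +
      (N * (linCoeff α β K m n N + linCoeff α β K m (n - 1) N +
        linCoeff α β K (m - 1) n N + linCoeff α β K (m - 1) (n - 1) N) -
      ((m + n) * linCoeff α β K m n N +
        (1 - (α + β + 1) - (n - m)) * linCoeff α β K m (n - 1) N +
        (1 - (α + β + 1) + (n - m)) * linCoeff α β K (m - 1) n N -
        (m + n - 2 + 2 * (α + β + 1)) * linCoeff α β K (m - 1) (n - 1) N)) * h2
  let F : ℕ → ℝ[X] := fun N => C (E N) * (euler (jacPoly α β N) - C (N : ℝ) * jacPoly α β N)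
  have hF : ∀ N : ℕ, C ((2 * N + (α + β + 1)) * jacWeight α β N * e N) * euler (jacPoly α β N) -
      C ((2 * N + (α + β + 1)) * jacWeight α β N * f N) * jacPoly α β N = F N - F (N + 1) := by
    intro N
    have h1 := euler_jacPoly h (N + 1)
    rw [show (N : ℤ) + 1 - 1 = N by ring, euler_add] at h1
    have h2 : (2 * N + (α + β + 1)) * jacWeight α β N * e N = E N + E (N + 1) := by
      rw [hE]; simp only [E]; ring
    have h3 : (2 * N + (α + β + 1)) * jacWeight α β N * f N =
        N * E N - (N + (α + β + 1)) * E (N + 1) := by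
      rw [hE]; simp only [E]; ring
    simp only [F]
    rw [h2, h3]
    push_cast at h1 ⊢
    simp only [C_add, C_sub, C_mul, C_1] at h1 ⊢
    linear_combination C (E (N + 1)) * h1
  have hsum : ∑ N ∈ Finset.range K,
      (C ((2 * N + (α + β + 1)) * jacWeight α β N * e N) * euler (jacPoly α β N) -
        C ((2 * N + (α + β + 1)) * jacWeight α β N * f N) * jacPoly α β N) = 0 := by
    rw [Finset.sum_congr rfl fun N _ => hF N, Finset.sum_range_sub']
    have h0 : F 0 = 0 := by
      simp [F, jacPoly, euler]
    have hK : F K = 0 := by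
      simp only [F, E, e, f]
      rw [linCoeff_of_lt α β K hmn, linCoeff_of_lt α β K (show m + (n - 1) < K by omega),
        linCoeff_of_lt α β K (show m - 1 + n < K by omega),
        linCoeff_of_lt α β K (show m - 1 + (n - 1) < K by omega)]
      simp
    rw [h0, hK, sub_zero]
  rw [EulerRelation, ← sub_eq_zero, ← hsum]
  simp only [linExpansion, Finset.mul_sum, ← Finset.sum_add_distrib, ← Finset.sum_sub_distrib,
    euler_sum, euler_add, euler_C_mul]
  refine Finset.sum_congr rfl fun N _ => ?_
  simp only [e, f, C_add, C_sub, C_mul, C_1]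
  ring

lemma linExpansion_of_left_neg (α β : ℝ) (K : ℕ) {m : ℤ} (hm : m < 0) (n : ℤ) :
    linExpansion α β K m n = 0 := by
  refine Finset.sum_eq_zero fun N _ => ?_
  have : linCoeff α β K m n N = 0 := Finset.sum_eq_zero fun r _ => by
    rw [linSummand, gegen_of_neg β (show m - (r : ℤ) < 0 by omega)]; ring
  rw [this]
  simp

lemma linExpansion_of_right_neg (α β : ℝ) (K : ℕ) (m : ℤ) {n : ℤ} (hn : n < 0) :
    linExpansion α β K m n = 0 := by
  refine Finset.sum_eq_zero fun N _ => ?_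
  have : linCoeff α β K m n N = 0 := Finset.sum_eq_zero fun r _ => by
    rw [linSummand, gegen_of_neg β (show n - (r : ℤ) < 0 by omega)]; ring
  rw [this]
  simp

lemma natDegree_jacPoly_le (α β : ℝ) (n : ℕ) : (jacPoly α β n).natDegree ≤ n := by
  rw [natDegree_le_iff_coeff_eq_zero]
  intro i hi
  rw [coeff_jacPoly, jacCoeff_of_lt α β (by exact_mod_cast hi)]

lemma coeff_linExpansion_top {α β : ℝ} {K m n : ℕ} (hK : m + n < K) :
    (linExpansion α β K m n).coeff (m + n) = topWeight α β (m + n) * topSum α β K m n := by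
  rw [linExpansion, finsetSum_coeff,
    Finset.sum_eq_single_of_mem (m + n) (Finset.mem_range.2 hK)]
  · rw [coeff_C_mul, coeff_jacPoly, topWeight]
    push_cast
    rw [linCoeff_top]
    ring
  · intro N _ hN
    rw [coeff_C_mul, coeff_jacPoly]
    rcases lt_or_gt_of_ne hN with h1 | h1
    · rw [jacCoeff_of_lt α β (by exact_mod_cast h1), mul_zero]
    · rw [linCoeff_of_lt α β K (show (m : ℤ) + n < N by omega), mul_zero, zero_mul]

lemma linExpansion_eq_aux {α β : ℝ} (h : GenericPair α β) {K : ℕ} (k : ℕ) :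
    ∀ m n : ℤ, m + n + 2 ≤ k → m + n < K →
      linExpansion α β K m n = C (linConst α β) * (jacPoly α β m * jacPoly α β n) := by
  induction k with
  | zero =>
    intro m n hk _
    rcases lt_or_ge m 0 with hm | hm
    · rw [linExpansion_of_left_neg α β K hm, jacPoly_of_neg α β hm, zero_mul, mul_zero]
    · have hn : n < 0 := by push_cast at hk; omega
      rw [linExpansion_of_right_neg α β K _ hn, jacPoly_of_neg α β hn, mul_zero, mul_zero]
  | succ k ih =>
    intro m n hk hK
    rcases lt_or_ge m 0 with hm | hm
    · rw [linExpansion_of_left_neg α β K hm, jacPoly_of_neg α β hm, zero_mul, mul_zero]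
    rcases lt_or_ge n 0 with hn | hn
    · rw [linExpansion_of_right_neg α β K _ hn, jacPoly_of_neg α β hn, mul_zero, mul_zero]
    push_cast at hk
    lift m to ℕ using hm
    lift n to ℕ using hn
    have h1 := eulerRelation_linExpansion h (show (m : ℤ) < K by omega) hK
    have h2 := eulerRelation_mul h m n
    rw [EulerRelation, ih m (n - 1) (by omega) (by omega), ih (m - 1) n (by omega) (by omega),
      ih (m - 1) (n - 1) (by omega) (by omega)] at h1
    rw [EulerRelation] at h2
    obtain ⟨D, hD⟩ : ∃ D, D = linExpansion α β K m n -
      C (linConst α β) * (jacPoly α β m * jacPoly α β n) := ⟨_, rfl⟩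
    have hD' : linExpansion α β K m n =
      D + C (linConst α β) * (jacPoly α β m * jacPoly α β n) := by rw [hD]; ring
    have h3 : euler D = C ((m : ℝ) + n) * D := by
      rw [hD'] at h1
      simp only [euler_add, euler_C_mul] at h1 h2
      push_cast at h1 h2
      linear_combination h1 - C (linConst α β) * h2
    rw [← sub_eq_zero, ← hD]
    ext i
    rw [coeff_zero]
    by_cases hi : i = m + n
    · subst hi
      rw [hD, coeff_sub, coeff_linExpansion_top (by omega), coeff_C_mul,
        coeff_mul_add_eq_of_natDegree_le (natDegree_jacPoly_le α β m) (natDegree_jacPoly_le α β n),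
        topWeight_mul_topSum h (by omega), coeff_jacPoly, coeff_jacPoly, sub_self]
    · have h4 := congrArg (fun p => coeff p i) h3
      simp only [coeff_euler, coeff_C_mul] at h4
      have h5 : (i : ℝ) - (m + n) ≠ 0 := by
        rw [sub_ne_zero]
        exact_mod_cast hi
      refine (mul_eq_zero.1 (?_ : ((i : ℝ) - (m + n)) * D.coeff i = 0)).resolve_left h5
      linear_combination h4

lemma linExpansion_eq {α β : ℝ} (h : GenericPair α β) {K m n : ℕ} (hK : m + n < K) :
    linExpansion α β K m n = C (linConst α β) * (jacPoly α β m * jacPoly α β n) :=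
  linExpansion_eq_aux h (m + n + 2) m n (by push_cast; omega) (by exact_mod_cast hK)

lemma poch_zero (t : ℝ) : poch t 0 = 1 := by simp [poch]

lemma poch_succ (t : ℝ) (j : ℕ) : poch t (j + 1) = poch t j * (t + j) :=
  ascPochhammer_succ_eval j t

lemma poch_mul_gammaShift {x : ℝ} (hx : ∀ z : ℤ, x ≠ z) (i : ℤ) (k : ℕ) :
    poch (x + i) k * gammaShift x i = gammaShift x (i + k) := by
  induction k with
  | zero => simp [poch_zero]
  | succ k ih =>
    have := gammaShift_succ hx (i + k)
    push_cast at this ⊢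
    rw [poch_succ, ← add_assoc, this, ← ih]
    ring

lemma poch_eq_div {x : ℝ} (hx : ∀ z : ℤ, x ≠ z) (k : ℕ) :
    poch x k = gammaShift x k / gammaShift x 0 := by
  rw [eq_div_iff (gammaShift_ne_zero hx 0)]
  simpa using poch_mul_gammaShift hx 0 k

lemma poch_neg_natCast (n j : ℕ) :
    poch (-(n : ℝ)) j = (-1) ^ j * n.factorial * invFact ((n : ℤ) - j) := by
  induction j with
  | zero =>
    rw [poch_zero, Nat.cast_zero, sub_zero, invFact_natCast]
    field_simp
  | succ j ih =>
    have := invFact_eq_mul_succ ((n : ℤ) - (j + 1))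
    rw [show (n : ℤ) - (j + 1) + 1 = n - j by ring] at this
    push_cast at this ⊢
    rw [poch_succ, ih, this]
    ring

lemma poch_one_sub_mul {x : ℝ} (hx : ∀ z : ℤ, x ≠ z) (i : ℤ) (k : ℕ) :
    poch (1 - x - i) k * gammaShift x (i - k) = (-1) ^ k * gammaShift x i := by
  induction k with
  | zero => simp [poch_zero]
  | succ k ih =>
    have := gammaShift_succ hx (i - (k + 1))
    rw [show i - ((k : ℤ) + 1) + 1 = i - k by ring] at this
    push_cast at this ⊢
    rw [this] at ih
    rw [poch_succ, pow_succ]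
    linear_combination -ih

lemma poch_natCast_add_one (d k : ℕ) : poch ((d : ℝ) + 1) k * d.factorial = (d + k).factorial := by
  induction k with
  | zero => simp [poch_zero]
  | succ k ih =>
    rw [poch_succ, ← add_assoc, Nat.factorial_succ]
    push_cast
    rw [← ih]
    ring

lemma gammaShift_two_mul {x : ℝ} (hx : ∀ z : ℤ, x ≠ z) (hx' : ∀ z : ℤ, x + 1 / 2 ≠ z)
    (hx2 : ∀ z : ℤ, 2 * x ≠ z) (n : ℕ) :
    gammaShift (2 * x) (2 * n) * (gammaShift x 0 * gammaShift (x + 1 / 2) 0) =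
      4 ^ n * gammaShift (2 * x) 0 * (gammaShift x n * gammaShift (x + 1 / 2) n) := by
  induction n with
  | zero => simp
  | succ n ih =>
    have h1 := gammaShift_succ hx n
    have h2 := gammaShift_succ hx' n
    have h3 := gammaShift_succ hx2 (2 * n)
    have h4 := gammaShift_succ hx2 (2 * n + 1)
    push_cast at *
    rw [show 2 * ((n : ℤ) + 1) = 2 * n + 1 + 1 by ring, h4, h3, h1, h2, pow_succ]
    linear_combination (2 * x + (2 * n + 1)) * (2 * x + 2 * n) * ih

lemma factorial_two_mul_mul (m : ℕ) :
    ((2 * m).factorial : ℝ) * gammaShift (1 / 2) 0 =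
      4 ^ m * m.factorial * gammaShift (1 / 2) m := by
  induction m with
  | zero => simp
  | succ m ih =>
    have h1 := gammaShift_succ half_ne_intCast m
    rw [show 2 * (m + 1) = 2 * m + 1 + 1 by ring, Nat.factorial_succ, Nat.factorial_succ,
      Nat.factorial_succ, pow_succ]
    push_cast at *
    rw [h1]
    linear_combination (2 * m + 1 + 1) * (2 * m + 1) * ih

/-- The ratio of the normalisations of `jacobiP` and `jacPoly`. -/
noncomputable def jacRatio (α β : ℝ) (n : ℕ) : ℝ :=
  gammaShift (α + 1) n / gammaShift (α + β + 1) n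

lemma jacobiP_eq {α β : ℝ} (h : GenericPair α β) (n : ℕ) (x : ℝ) :
    jacobiP α β n x = jacRatio α β n * (jacPoly α β n).eval ((1 - x) / 2) := by
  have e : ((n : ℤ) + 1).toNat = n + 1 := by omega
  rw [jacobiP, jacPoly, eval_finsetSum, e, Finset.mul_sum, Finset.mul_sum]
  refine Finset.sum_congr rfl fun j hj => ?_
  rw [eval_mul, eval_C, eval_pow, eval_X, ← mul_assoc, ← mul_assoc]
  congr 1
  have h1 := poch_mul_gammaShift h.add_add_one n j
  have h2 := gammaShift_ne_zero h.add_add_one n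
  have h3 := gammaShift_ne_zero h.left_add_one 0
  have h4 := gammaShift_ne_zero h.left_add_one j
  rw [← eq_div_iff h2] at h1
  push_cast at h1
  rw [show (n : ℝ) + α + β + 1 = α + β + 1 + n by ring, h1, poch_eq_div h.left_add_one,
    poch_eq_div h.left_add_one, poch_neg_natCast, jacRatio, jacCoeff, invFact_natCast]
  field_simp

lemma linCoeff_of_lt_sub (α β : ℝ) (K : ℕ) {m n N : ℤ} (hN : N < n - m) :
    linCoeff α β K m n N = 0 := by
  refine Finset.sum_eq_zero fun r _ => ?_
  rcases lt_or_ge m r with hr | hr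
  · rw [linSummand, gegen_of_neg β (show m - (r : ℤ) < 0 by omega)]; ring
  · rw [linSummand, connKernel_of_lt α β (show N < m + n - 2 * r by omega)]; ring

/-- The summands of the linearization coefficient, indexed from the last nonzero one. -/
noncomputable def rahSummand (α β : ℝ) (m d k j : ℕ) : ℝ :=
  gammaFact (α - β) (k - 2 * j) * gammaQuot (α + β + 1) (2 * β + 2) (2 * d + k + 2 * j) *
    innerFactor α β (m + d + j) (m - j) * (d + 2 * j + β + 1 / 2) *
    (gegen β (d + j) * gegen β j)

lemma linCoeff_eq_sum (α β : ℝ) {K m : ℕ} (hK : m < K) (d k : ℕ) :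
    linCoeff α β K m (m + d : ℕ) (d + k : ℕ) =
      outerFactor α β (2 * m + d) (d + k) * ∑ j ∈ Finset.range (m + 1), rahSummand α β m d k j := by
  have : linCoeff α β K m (m + d : ℕ) (d + k : ℕ) =
      ∑ r ∈ Finset.range (m + 1), linSummand α β m (m + d : ℕ) (d + k : ℕ) r := by
    refine (Finset.sum_subset (Finset.range_mono (by omega)) fun r _ hr => ?_).symm
    rw [Finset.mem_range, not_lt] at hr
    rw [linSummand, gegen_of_neg β (show (m : ℤ) - (r : ℤ) < 0 by omega)]; ring
  rw [this, ← Finset.sum_range_reflect, Finset.mul_sum]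
  refine Finset.sum_congr rfl fun j hj => ?_
  rw [Finset.mem_range] at hj
  have e : ((m + 1 - 1 - j : ℕ) : ℤ) = m - j := by omega
  rw [e, linSummand, rahSummand, connKernel]
  push_cast
  rw [show (m : ℤ) + (m + d) = 2 * m + d by ring,
    show (d : ℤ) + k - (2 * m + d - 2 * (m - j)) = k - 2 * j by ring,
    show (d : ℤ) + k + (2 * m + d - 2 * (m - j)) = 2 * d + k + 2 * j by ring,
    show 2 * (m : ℤ) + d - (m - j) = m + d + j by ring,
    show (m : ℤ) + d - (m - j) = d + j by ring,
    show (m : ℤ) - (m - j) = j by ring]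
  ring

lemma jacobiP_mul_generic {α β : ℝ} (h : GenericPair α β) (hc : linConst α β ≠ 0)
    (m d : ℕ) (x : ℝ) :
    jacobiP α β m x * jacobiP α β (m + d) x =
      ∑ k ∈ Finset.range (2 * m + 1),
        (jacRatio α β m * jacRatio α β (m + d) / (linConst α β * jacRatio α β (d + k)) *
          ((2 * (d + k) + (α + β + 1)) * jacWeight α β (d + k)) *
          (outerFactor α β (2 * m + d) (d + k) *
            ∑ j ∈ Finset.range (m + 1), rahSummand α β m d k j)) * jacobiP α β (k + d) x := by
  have key := congrArg (eval ((1 - x) / 2))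
    (linExpansion_eq h (show m + (m + d) < d + (2 * m + 1) by omega))
  rw [linExpansion, Finset.sum_range_add, Finset.sum_eq_zero fun N hN => ?_, zero_add] at key
  swap
  · rw [Finset.mem_range] at hN
    rw [linCoeff_of_lt_sub α β _ (by push_cast; omega)]
    simp
  simp only [eval_finsetSum, eval_mul, eval_C] at key
  rw [jacobiP_eq h, jacobiP_eq h, show ∀ a b c d : ℝ, a * b * (c * d) =
    a * c / linConst α β * (linConst α β * (b * d)) by intros; field_simp, ← key, Finset.mul_sum]
  refine Finset.sum_congr rfl fun k _ => ?_
  have h1 : jacRatio α β (d + k) ≠ 0 :=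
    div_ne_zero (gammaShift_ne_zero h.left_add_one _) (gammaShift_ne_zero h.add_add_one _)
  rw [linCoeff_eq_sum α β (by omega), jacobiP_eq h, add_comm k d]
  push_cast
  field_simp

/-- `(t + 1)_{j - 1} (t + 2 j)` for positive `j`, and `1` for `j = 0`: the regularised form of
`(t)_j (t / 2 + 1)_j / (t / 2)_j`. -/
noncomputable def wellPoised (t : ℝ) : ℕ → ℝ
  | 0 => 1
  | j + 1 => poch (t + 1) j * (t + 2 * (j + 1))

lemma poch_succ' (t : ℝ) (j : ℕ) : poch t (j + 1) = t * poch (t + 1) j := by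
  rw [poch, poch, ascPochhammer_succ_left]
  simp

lemma mul_wellPoised (t : ℝ) (j : ℕ) : t * wellPoised t j = poch t j * (t + 2 * j) := by
  cases j with
  | zero => simp [wellPoised, poch_zero]
  | succ j =>
    rw [wellPoised, poch_succ']
    push_cast
    ring

lemma wellPoised_succ_mul (t : ℝ) (j : ℕ) :
    t * wellPoised t (j + 1) * (t + 2 * j) =
      t * wellPoised t j * ((t + j) * (t + 2 * (j + 1))) := by
  rw [mul_wellPoised, mul_wellPoised, poch_succ]
  push_cast
  ring

/-- The summands of the hypergeometric factor of `aRah`, in regularised form. -/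
noncomputable def rahTerm (α β : ℝ) (m d k j : ℕ) : ℝ :=
  wellPoised (β + d + 1 / 2) j * poch (β + 1 / 2) j * poch (β + (m + d) + 1) j *
    poch (-α - m) j * poch ((α + β + k + 1) / 2 + d) j * poch ((α + β + k + 2) / 2 + d) j *
    (poch (-(k : ℝ) / 2) j * poch ((1 - (k : ℝ)) / 2) j) /
  (poch ((d : ℝ) + 1) j * poch (1 / 2 - (m : ℝ)) j * poch (α + β + (m + d) + 3 / 2) j *
    poch ((β - α - k + 1) / 2) j * poch ((β - α - k + 2) / 2) j *
    poch (((k : ℝ) + 2) / 2 + β + d) j * poch (((k : ℝ) + 3) / 2 + β + d) j * j.factorial)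

lemma add_intCast_ne_zero {x : ℝ} (hx : ∀ z : ℤ, x ≠ z) (z : ℤ) : x + z ≠ 0 := fun h =>
  hx (-z) (by push_cast; linarith)

lemma rahSummand_succ {α β : ℝ} (h : GenericPair α β) (m d k j : ℕ) :
    rahSummand α β m d k (j + 1) =
      rahSummand α β m d k j *
        (((k - 2 * j - 1) * (k - 2 * j) * ((α + β + 1 + (2 * d + k + 2 * j)) *
          (α + β + 1 + (2 * d + k + 2 * j) + 1)) * (β + 1 + (m + d + j)) * (α + (m - j)) *
          (d + 2 * (j + 1) + β + 1 / 2) * (β + 1 / 2 + (d + j)) * (β + 1 / 2 + j)) /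
        ((α - β + (k - 2 * j - 2)) * (α - β + (k - 2 * j - 1)) *
          ((2 * β + 2 + (2 * d + k + 2 * j)) * (2 * β + 2 + (2 * d + k + 2 * j) + 1)) *
          (α + β + 3 / 2 + (m + d + j)) * (1 / 2 + (m - j - 1)) *
          (d + 2 * j + β + 1 / 2) * (d + j + 1) * (j + 1))) := by
  have h1 := gammaFact_two_step h.sub (k - 2 * j - 2)
  have h2 := gammaQuot_two_step h.add_add_one h.two_right_add_two (2 * d + k + 2 * j)
  have h3 := gammaQuot_succ_mul h.right_add_one h.add_add_three_halves (m + d + j)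
  have h4 := gammaQuot_succ_mul half_ne_intCast h.left_add_one (m - j - 1)
  have h5 := gegen_mul h (d + j + 1)
  have h6 := gegen_mul h (j + 1)
  have n1 := add_intCast_ne_zero h.sub (k - 2 * j - 2)
  have n2 := add_intCast_ne_zero h.sub (k - 2 * j - 1)
  have n3 := add_intCast_ne_zero h.two_right_add_two (2 * d + k + 2 * j)
  have n4 := add_intCast_ne_zero h.two_right_add_two (2 * d + k + 2 * j + 1)
  have n5 := add_intCast_ne_zero h.add_add_three_halves (m + d + j)
  have n6 := add_intCast_ne_zero half_ne_intCast (m - j - 1)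
  have n7 := add_intCast_ne_zero h.right_add_half (d + 2 * j)
  have n8 : (d : ℝ) + j + 1 ≠ 0 := by positivity
  have n9 : (j : ℝ) + 1 ≠ 0 := by positivity
  rw [show (k : ℤ) - 2 * j - 2 + 2 = k - 2 * j by ring] at h1
  rw [show (m : ℤ) - j - 1 + 1 = m - j by ring] at h4
  rw [show (d : ℤ) + j + 1 - 1 = d + j by ring] at h5
  rw [show (j : ℤ) + 1 - 1 = j by ring] at h6
  push_cast at *
  rw [show β + 1 / 2 + (d + 2 * (j : ℝ)) = d + 2 * j + β + 1 / 2 by ring] at n7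
  rw [← add_assoc] at n4
  have g1 : gammaFact (α - β) (k - 2 * j - 2) = gammaFact (α - β) (k - 2 * j) *
      ((k - 2 * j - 1) * (k - 2 * j)) /
        ((α - β + (k - 2 * j - 2)) * (α - β + (k - 2 * j - 1))) := by
    rw [eq_div_iff (mul_ne_zero n1 n2)]
    linear_combination -h1
  rw [← eq_div_iff (mul_ne_zero n3 n4)] at h2
  rw [← eq_div_iff n5] at h3
  have g4 : gammaQuot (1 / 2) (α + 1) (m - j - 1) =
      gammaQuot (1 / 2) (α + 1) (m - j) * (α + (m - j)) / (1 / 2 + (m - j - 1)) := by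
    rw [eq_div_iff n6]
    linear_combination -h4
  have g5 : gegen β (d + j + 1) = gegen β (d + j) * (β + 1 / 2 + (d + j)) / (d + j + 1) := by
    rw [eq_div_iff n8]
    linear_combination h5
  have g6 : gegen β (j + 1) = gegen β j * (β + 1 / 2 + j) / (j + 1) := by
    rw [eq_div_iff n9]
    linear_combination h6
  rw [rahSummand, rahSummand, innerFactor, innerFactor]
  push_cast
  rw [show (k : ℤ) - 2 * (j + 1) = k - 2 * j - 2 by ring,
    show 2 * (d : ℤ) + k + 2 * (j + 1) = 2 * d + k + 2 * j + 2 by ring,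
    show (m : ℤ) + d + (j + 1) = m + d + j + 1 by ring,
    show (m : ℤ) - (j + 1) = m - j - 1 by ring,
    show (d : ℤ) + (j + 1) = d + j + 1 by ring, g1, h2, h3, g4, g5, g6]
  generalize (α - β + ((k : ℝ) - 2 * j - 2)) = y1
  generalize (α - β + ((k : ℝ) - 2 * j - 1)) = y2
  generalize (2 * β + 2 + (2 * (d : ℝ) + k + 2 * j)) = y3
  generalize y3 + 1 = y4
  generalize (α + β + 3 / 2 + ((m : ℝ) + d + j)) = y5
  generalize (1 / 2 + ((m : ℝ) - j - 1)) = y6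
  generalize ((k : ℝ) - 2 * j - 1) = u1
  generalize ((k : ℝ) - 2 * j) = u2
  generalize (α + β + 1 + (2 * (d : ℝ) + k + 2 * j)) = u3
  generalize u3 + 1 = u4
  generalize (β + 1 + ((m : ℝ) + d + j)) = u5
  generalize (α + ((m : ℝ) - j)) = u6
  generalize ((d : ℝ) + 2 * (j + 1) + β + 1 / 2) = u7
  generalize (β + 1 / 2 + ((d : ℝ) + j)) = u8
  generalize (β + 1 / 2 + (j : ℝ)) = u9
  generalize (d + 2 * (j : ℝ) + β + 1 / 2) = y7 at n7 ⊢
  generalize ((d : ℝ) + j + 1) = y8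
  generalize ((j : ℝ) + 1) = y9
  generalize gammaFact (α - β) _ = v1
  generalize gammaQuot (α + β + 1) _ _ = v2
  generalize gammaQuot (β + 1) _ _ = v3
  generalize gammaQuot (1 / 2) _ _ = v4
  generalize gegen β (d + j) = v5
  generalize gegen β j = v6
  clear * - n7
  simp only [div_eq_mul_inv, mul_inv]
  linear_combination -(v1 * v2 * v3 * v4 * v5 * v6 * (u1 * u2 * u3 * u4 * u5 * u6 * u7 * u8 * u9) *
    (y1⁻¹ * y2⁻¹ * y3⁻¹ * y4⁻¹ * y5⁻¹ * y6⁻¹ * y8⁻¹ * y9⁻¹)) * mul_inv_cancel₀ n7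

lemma rahTerm_succ {α β : ℝ} (h : GenericPair α β) (m d k j : ℕ) :
    rahTerm α β m d k (j + 1) =
      rahTerm α β m d k j *
        (((k - 2 * j - 1) * (k - 2 * j) * ((α + β + 1 + (2 * d + k + 2 * j)) *
          (α + β + 1 + (2 * d + k + 2 * j) + 1)) * (β + 1 + (m + d + j)) * (α + (m - j)) *
          (d + 2 * (j + 1) + β + 1 / 2) * (β + 1 / 2 + (d + j)) * (β + 1 / 2 + j)) /
        ((α - β + (k - 2 * j - 2)) * (α - β + (k - 2 * j - 1)) *
          ((2 * β + 2 + (2 * d + k + 2 * j)) * (2 * β + 2 + (2 * d + k + 2 * j) + 1)) *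
          (α + β + 3 / 2 + (m + d + j)) * (1 / 2 + (m - j - 1)) *
          (d + 2 * j + β + 1 / 2) * (d + j + 1) * (j + 1))) := by
  have n0 := add_intCast_ne_zero h.right_add_half d
  have n7 := add_intCast_ne_zero h.right_add_half (d + 2 * j)
  push_cast at n0 n7
  have hw : wellPoised (β + d + 1 / 2) (j + 1) = wellPoised (β + d + 1 / 2) j *
      ((β + 1 / 2 + (d + j)) * (d + 2 * (j + 1) + β + 1 / 2)) / (d + 2 * j + β + 1 / 2) := by
    rw [eq_div_iff (by convert n7 using 1; ring)]
    have := wellPoised_succ_mul (β + d + 1 / 2) j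
    refine mul_left_cancel₀ n0 ?_
    linear_combination this
  rw [rahTerm, hw]
  simp only [poch_succ, Nat.factorial_succ, rahTerm]
  push_cast
  rw [show -(k : ℝ) / 2 + j = -(k - 2 * j) / 2 by ring,
    show (1 - (k : ℝ)) / 2 + j = -(k - 2 * j - 1) / 2 by ring,
    show (β - α - k + 1) / 2 + j = -(α - β + (k - 2 * j - 1)) / 2 by ring,
    show (β - α - k + 2) / 2 + j = -(α - β + (k - 2 * j - 2)) / 2 by ring,
    show ((k : ℝ) + 2) / 2 + β + d + j = (2 * β + 2 + (2 * d + k + 2 * j)) / 2 by ring,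
    show ((k : ℝ) + 3) / 2 + β + d + j = (2 * β + 2 + (2 * d + k + 2 * j) + 1) / 2 by ring,
    show (α + β + k + 1) / 2 + d + j = (α + β + 1 + (2 * d + k + 2 * j)) / 2 by ring,
    show (α + β + k + 2) / 2 + d + j = (α + β + 1 + (2 * d + k + 2 * j) + 1) / 2 by ring,
    show 1 / 2 - (m : ℝ) + j = -(1 / 2 + (m - j - 1)) by ring,
    show -α - m + j = -(α + ((m : ℝ) - j)) by ring,
    show β + ((m : ℝ) + d) + 1 + j = β + 1 + (m + d + j) by ring,
    show α + β + ((m : ℝ) + d) + 3 / 2 + j = α + β + 3 / 2 + (m + d + j) by ring,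
    show (d : ℝ) + 1 + j = d + j + 1 by ring]
  generalize (α - β + ((k : ℝ) - 2 * j - 2)) = y1
  generalize (α - β + ((k : ℝ) - 2 * j - 1)) = y2
  generalize (2 * β + 2 + (2 * (d : ℝ) + k + 2 * j)) = y3
  generalize y3 + 1 = y4
  generalize (α + β + 3 / 2 + ((m : ℝ) + d + j)) = y5
  generalize (1 / 2 + ((m : ℝ) - j - 1)) = y6
  generalize ((k : ℝ) - 2 * j - 1) = u1
  generalize ((k : ℝ) - 2 * j) = u2
  generalize (α + β + 1 + (2 * (d : ℝ) + k + 2 * j)) = u3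
  generalize u3 + 1 = u4
  generalize (β + 1 + ((m : ℝ) + d + j)) = u5
  generalize (α + ((m : ℝ) - j)) = u6
  generalize ((d : ℝ) + 2 * (j + 1) + β + 1 / 2) = u7
  generalize (β + 1 / 2 + ((d : ℝ) + j)) = u8
  generalize (β + 1 / 2 + (j : ℝ)) = u9
  generalize (d + 2 * (j : ℝ) + β + 1 / 2) = y7
  generalize ((d : ℝ) + j + 1) = y8
  generalize ((j : ℝ) + 1) = y9
  generalize wellPoised (β + d + 1 / 2) j = p1
  generalize poch (β + 1 / 2) j = p2
  generalize poch (β + (m + d) + 1) j = p3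
  generalize poch (-α - m) j = p4
  generalize poch ((α + β + k + 1) / 2 + d) j = p5
  generalize poch ((α + β + k + 2) / 2 + d) j = p6
  generalize poch (-(k : ℝ) / 2) j = p7
  generalize poch ((1 - (k : ℝ)) / 2) j = p8
  generalize poch ((d : ℝ) + 1) j = p9
  generalize poch (1 / 2 - (m : ℝ)) j = p10
  generalize poch (α + β + (m + d) + 3 / 2) j = p11
  generalize poch ((β - α - k + 1) / 2) j = p12
  generalize poch ((β - α - k + 2) / 2) j = p13
  generalize poch (((k : ℝ) + 2) / 2 + β + d) j = p14
  generalize poch (((k : ℝ) + 3) / 2 + β + d) j = p15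
  generalize (j.factorial : ℝ) = p16
  clear * -
  simp only [div_eq_mul_inv, mul_inv, inv_neg, inv_inv]
  ring

lemma rahSummand_eq {α β : ℝ} (h : GenericPair α β) (m d k j : ℕ) :
    rahSummand α β m d k j = rahSummand α β m d k 0 * rahTerm α β m d k j := by
  induction j with
  | zero => simp [rahTerm, wellPoised, poch_zero]
  | succ j ih => rw [rahSummand_succ h, rahTerm_succ h, ih, mul_assoc]

lemma linConst_eq {α β : ℝ} (h : GenericPair α β) :
    linConst α β = gammaShift (2 * (α + β + 1)) 0 * gammaShift (α - β) 0 * gammaShift (β + 1) 0 *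
      gammaShift (1 / 2) 0 * ((β + 1 / 2) * gammaShift (β + 1 / 2) 0 ^ 2) /
        (gammaShift (2 * β + 2) 0 * gammaShift (α + β + 3 / 2) 0 * gammaShift (α + β + 1) 0) := by
  have h1 := gammaShift_ne_zero h.add_add_one 0
  have h2 := gammaShift_ne_zero h.left_add_one 0
  have h3 : invFact 0 = 1 := by simpa using invFact_natCast 0
  have h4 := topWeight_eq h 0
  push_cast at h4
  rw [linConst, h4, topSummand, connKernel, innerFactor, gegen, jacCoeff]
  simp only [gammaFact, gammaQuot, add_zero, sub_zero, mul_zero, h3, Int.cast_zero, pow_zero,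
    mul_one, one_mul, zero_add, CharP.cast_eq_zero]
  field_simp

lemma linConst_ne_zero {α β : ℝ} (h : GenericPair α β) : linConst α β ≠ 0 := by
  have h1 := gammaShift_ne_zero h.two_add_add_one 0
  have h2 := gammaShift_ne_zero h.sub 0
  have h3 := gammaShift_ne_zero h.right_add_one 0
  have h4 := gammaShift_ne_zero half_ne_intCast 0
  have h5 := gammaShift_ne_zero h.right_add_half 0
  have h6 := gammaShift_ne_zero h.two_right_add_two 0
  have h7 := gammaShift_ne_zero h.add_add_three_halves 0
  have h8 := gammaShift_ne_zero h.add_add_one 0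
  have h9 : β + 1 / 2 ≠ 0 := by simpa using h.right_add_half 0
  rw [linConst_eq h]
  positivity

lemma gammaShift_add_one (x : ℝ) (i : ℤ) : gammaShift (x + 1) i = gammaShift x (i + 1) := by
  rw [gammaShift, gammaShift]
  push_cast
  ring_nf

lemma linConst_mul {α β : ℝ} (h : GenericPair α β) (m d : ℕ) :
    linConst α β * (gammaShift (α + β + 1) (m + d) * gammaShift (α + β + 3 / 2) (m + d) *
      (2 * m).factorial * gammaShift (2 * β + 2) (2 * d)) =
    gammaShift (1 / 2) m * ((d + β + 1 / 2) * gammaShift (β + 1 / 2) d) *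
      gammaShift (β + 1 / 2) 0 * m.factorial * gammaShift (β + 1) d *
      gammaShift (2 * (α + β + 1)) (2 * (m + d)) * gammaShift (α - β) 0 := by
  have hβ : ∀ z : ℤ, β + 1 + 1 / 2 ≠ z := fun z e => h.right_add_half (z - 1) (by
    push_cast; linarith)
  have h1 := gammaShift_two_mul h.add_add_one
    (fun z e => h.add_add_three_halves z (by linarith)) h.two_add_add_one (m + d)
  have h2 := factorial_two_mul_mul m
  have h3 := gammaShift_two_mul h.right_add_one hβ
    (fun z e => h.two_right_add_two z (by linarith)) d
  have n1 := gammaShift_ne_zero h.two_add_add_one 0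
  have n3 := gammaShift_ne_zero h.right_add_one 0
  have n4 := gammaShift_ne_zero half_ne_intCast 0
  have n5 := gammaShift_ne_zero h.right_add_half 0
  have n6 := gammaShift_ne_zero h.two_right_add_two 0
  have n7 := gammaShift_ne_zero h.add_add_three_halves 0
  have n8 := gammaShift_ne_zero h.add_add_one 0
  have n9 : β + 1 / 2 ≠ 0 := by simpa using h.right_add_half 0
  rw [show β + 1 + 1 / 2 = β + 1 / 2 + 1 by ring, gammaShift_add_one (β + 1 / 2),
    gammaShift_add_one (β + 1 / 2),
    gammaShift_succ h.right_add_half, gammaShift_succ h.right_add_half,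
    show 2 * (β + 1) = 2 * β + 2 by ring] at h3
  rw [show α + β + 1 + 1 / 2 = α + β + 3 / 2 by ring] at h1
  push_cast at h1 h2 h3
  rw [add_zero] at h3
  rw [← eq_div_iff (mul_ne_zero n8 n7)] at h1
  rw [← eq_div_iff n4] at h2
  rw [← eq_div_iff (mul_ne_zero n3 (mul_ne_zero n9 n5))] at h3
  rw [linConst_eq h, h1, h2, h3, show β + 1 / 2 + (d : ℝ) = d + β + 1 / 2 by ring, pow_add]
  generalize gammaShift (α - β) 0 = v1
  generalize gammaShift (1 / 2) m = v2
  generalize gammaShift (β + 1 / 2) d = v3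
  generalize gammaShift (β + 1) d = v4
  generalize gammaShift (α + β + 1) (m + d) = v5
  generalize gammaShift (α + β + 3 / 2) (m + d) = v6
  generalize (d + β + 1 / 2) = v7
  generalize (4 ^ d : ℝ) = v8
  generalize (4 ^ m : ℝ) = v9
  generalize gammaShift (2 * (α + β + 1)) 0 = u1 at *
  generalize gammaShift (β + 1) 0 = u3 at *
  generalize gammaShift (1 / 2) 0 = u4 at *
  generalize gammaShift (β + 1 / 2) 0 = u5 at *
  generalize gammaShift (2 * β + 2) 0 = u6 at *
  generalize gammaShift (α + β + 3 / 2) 0 = u7 at *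
  generalize gammaShift (α + β + 1) 0 = u8 at *
  generalize β + 1 / 2 = u9 at *
  generalize (m.factorial : ℝ) = w
  clear * - n1 n3 n4 n5 n6 n7 n8 n9
  grind

/-- The factor of `aRah` in front of the hypergeometric sum. -/
noncomputable def rahPrefactor (α β : ℝ) (m d k : ℕ) : ℝ :=
  (poch (α + 1) (m + d) * poch (β + 1) (m + d) * poch (α + β + 1) (2 * d) *
      poch (α + β + 1) (2 * m) * (2 * (d + k) + (α + β + 1))) /
    (m.factorial * poch (α + β + 1) m * poch (α + 1) d * poch (β + 1) d *
      poch (α + β + 2) (2 * (m + d)) * (α + β + 1)) *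
  ((poch ((d : ℝ) + 1) k * poch (α + β + 1 + 2 * d) k *
      poch (2 * (α + β + 1) + 2 * (m + d)) k * poch (-2 * (m : ℝ)) k * poch (α - β) k) /
    (k.factorial * poch (2 * β + 2 + 2 * d) k * poch (α + 1 + d) k *
      poch (α + β + 2 + 2 * (m + d)) k * poch (-α - β - 2 * (m : ℝ)) k))

lemma rahPrefactor_eq {α β : ℝ} (h : GenericPair α β) {m k : ℕ} (hk : k ≤ 2 * m) (d : ℕ) :
    jacRatio α β m * jacRatio α β (m + d) / (linConst α β * jacRatio α β (d + k)) *
        ((2 * (d + k) + (α + β + 1)) * jacWeight α β (d + k)) *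
        (outerFactor α β (2 * m + d) (d + k) * rahSummand α β m d k 0) =
      rahPrefactor α β m d k := by
  have ga := gammaShift_ne_zero h.add_add_one
  have gA := gammaShift_ne_zero h.left_add_one
  have gB := gammaShift_ne_zero h.right_add_one
  have gh := gammaShift_ne_zero h.add_add_three_halves
  have g2 := gammaShift_ne_zero h.two_add_add_one
  have gb := gammaShift_ne_zero h.two_right_add_two
  have gd := gammaShift_ne_zero h.sub
  have gl := gammaShift_ne_zero h.right_add_half
  have gH := gammaShift_ne_zero half_ne_intCast
  have na : α + β + 1 ≠ 0 := by simpa using h.add_add_one 0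
  have nd : d + β + 1 / 2 ≠ 0 := by
    have := add_intCast_ne_zero h.right_add_half d
    push_cast at this
    convert this using 1
    ring
  have hinv : invFact 0 = 1 := by simpa using invFact_natCast 0
  have fm : (m.factorial : ℝ) ≠ 0 := by positivity
  have fk : (k.factorial : ℝ) ≠ 0 := by positivity
  have fd : (d.factorial : ℝ) ≠ 0 := by positivity
  have fdk : ((d + k).factorial : ℝ) ≠ 0 := by positivity
  have f2m : ((2 * m).factorial : ℝ) ≠ 0 := by positivity
  have f2mk : ((2 * m - k).factorial : ℝ) ≠ 0 := by positivity
  have s1 : ((-1 : ℝ) ^ k) ≠ 0 := by positivity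
  have hκ := linConst_mul h m d
  rw [← eq_div_iff (mul_ne_zero (mul_ne_zero (mul_ne_zero (ga _) (gh _)) f2m) (gb _))] at hκ
  have p1 := poch_natCast_add_one d k
  have p2 := poch_mul_gammaShift h.add_add_one (2 * d) k
  have p3 := poch_mul_gammaShift h.two_add_add_one (2 * (m + d)) k
  have p4 := poch_mul_gammaShift h.two_right_add_two (2 * d) k
  have p5 := poch_mul_gammaShift h.left_add_one d k
  have p6 := poch_mul_gammaShift h.add_add_two (2 * (m + d)) k
  have p7 := poch_one_sub_mul h.add_add_one (2 * m) k
  have p8 := poch_neg_natCast (2 * m) k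
  have p9 := gammaShift_succ h.add_add_one 0
  rw [← Nat.cast_sub hk, invFact_natCast] at p8
  rw [show α + β + 2 = α + β + 1 + 1 by ring] at p6
  simp only [gammaShift_add_one (α + β + 1)] at p6
  rw [← eq_div_iff (by positivity)] at p1
  rw [← eq_div_iff (ga _)] at p2 p7
  rw [← eq_div_iff (g2 _)] at p3
  rw [← eq_div_iff (gb _)] at p4
  rw [← eq_div_iff (gA _)] at p5
  rw [← eq_div_iff (ga _)] at p6
  push_cast at p1 p2 p3 p4 p5 p6 p7 p8 p9
  rw [add_zero] at p9
  rw [show 1 - (α + β + 1) - 2 * (m : ℝ) = -α - β - 2 * m by ring] at p7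
  rw [← neg_mul] at p8
  rw [rahPrefactor, jacRatio, jacRatio, jacRatio, jacWeight, outerFactor, rahSummand, hκ,
    innerFactor, gegen, gegen, show α + β + 2 = α + β + 1 + 1 by ring, p1, p2, p3, p4, p5, p6, p7, p8,
    poch_eq_div h.left_add_one, poch_eq_div h.left_add_one, poch_eq_div h.right_add_one,
    poch_eq_div h.right_add_one, poch_eq_div h.add_add_one, poch_eq_div h.add_add_one,
    poch_eq_div h.add_add_one, poch_eq_div h.sub,
    poch_eq_div (fun z e => h.add_add_two z (by linarith)), gammaQuot, gammaQuot, gammaQuot,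
    gammaQuot, gammaFact, gammaFact, gammaFact, gammaFact]
  push_cast
  simp only [gammaShift_add_one (α + β + 1), mul_zero, add_zero, sub_zero, zero_add]
  rw [show 2 * (m : ℤ) + d - (d + k) = ((2 * m - k : ℕ) : ℤ) by omega,
    show 2 * (m : ℤ) + d + (d + k) = 2 * (m + d) + k by ring]
  simp only [invFact_natCast, hinv, mul_one]
  rw [show ((2 * m - k : ℕ) : ℤ) = 2 * m - k by omega, p9]
  have nA1 := gA m
  have nA2 := gA (m + d)
  have nA3 := gA (d + k)
  have nA4 := gA 0
  have nA5 := gA d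
  have nB1 := gB (m + d)
  have nB2 := gB d
  have nB3 := gB 0
  have nl1 := gl d
  have nl2 := gl 0
  have nc1 := gH m
  have nd1 := gd k
  have nd2 := gd 0
  have nh1 := gh (m + d)
  have nb1 := gb (2 * d)
  have nb2 := gb (2 * d + k)
  have ne1 := g2 (2 * (m + d))
  have ne2 := g2 (2 * (m + d) + k)
  have na1 := ga m
  have na2 := ga (m + d)
  have na3 := ga (d + k)
  have na5 := ga (2 * d)
  have na6 := ga (2 * d + k)
  have na7 := ga (2 * (m + d) + k + 1)
  have na8 := ga (2 * (m + d) + 1)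
  have na9 := ga (2 * m)
  have na10 := ga (2 * m - k)
  have na11 := ga 0
  generalize gammaShift (α + 1) m = A1 at *
  generalize gammaShift (α + 1) (m + d) = A2 at *
  generalize gammaShift (α + 1) (d + k) = A3 at *
  generalize gammaShift (α + 1) 0 = A4 at *
  generalize gammaShift (α + 1) d = A5 at *
  generalize gammaShift (β + 1) (m + d) = B1 at *
  generalize gammaShift (β + 1) d = B2 at *
  generalize gammaShift (β + 1) 0 = B3 at *
  generalize gammaShift (β + 1 / 2) d = l1 at *
  generalize gammaShift (β + 1 / 2) 0 = l2 at *
  generalize gammaShift (1 / 2) m = c1 at *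
  generalize gammaShift (α - β) k = d1 at *
  generalize gammaShift (α - β) 0 = d2 at *
  generalize gammaShift (α + β + 3 / 2) (m + d) = h1 at *
  generalize gammaShift (2 * β + 2) (2 * d) = b1 at *
  generalize gammaShift (2 * β + 2) (2 * d + k) = b2 at *
  generalize gammaShift (2 * (α + β + 1)) (2 * (m + d)) = e1 at *
  generalize gammaShift (2 * (α + β + 1)) (2 * (m + d) + k) = e2 at *
  generalize gammaShift (α + β + 1) m = a1 at *
  generalize gammaShift (α + β + 1) (m + d) = a2 at *
  generalize gammaShift (α + β + 1) (d + k) = a3 at *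
  generalize gammaShift (α + β + 1) (2 * d) = a5 at *
  generalize gammaShift (α + β + 1) (2 * d + k) = a6 at *
  generalize gammaShift (α + β + 1) (2 * (m + d) + k + 1) = a7 at *
  generalize gammaShift (α + β + 1) (2 * (m + d) + 1) = a8 at *
  generalize gammaShift (α + β + 1) (2 * m) = a9 at *
  generalize gammaShift (α + β + 1) (2 * m - k) = a10 at *
  generalize gammaShift (α + β + 1) 0 = a11 at *
  generalize (m.factorial : ℝ) = f1 at *
  generalize (k.factorial : ℝ) = f2 at *
  generalize (d.factorial : ℝ) = f3 at *
  generalize ((d + k).factorial : ℝ) = f4 at *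
  generalize ((2 * m).factorial : ℝ) = f5 at *
  generalize ((2 * m - k).factorial : ℝ) = f6 at *
  generalize ((-1 : ℝ) ^ k) = f7 at *
  generalize (2 * ((d : ℝ) + k) + (α + β + 1)) = f8 at *
  generalize (d + β + 1 / 2) = f9 at *
  generalize α + β + 1 = f10 at *
  clear * - na nd fm fk fd fdk f2m f2mk s1 nA1 nA2 nA3 nA4 nA5 nB1 nB2 nB3 nl1 nl2 nc1 nd1 nd2 nh1 nb1 nb2 ne1 ne2 na1 na2 na3 na5 na6 na7 na8 na9 na10 na11
  simp only [div_eq_mul_inv, mul_inv, inv_inv]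
  grind

lemma jacobiP_mul_eq_sum {α β : ℝ} (h : GenericPair α β) (m d : ℕ) (x : ℝ) :
    jacobiP α β m x * jacobiP α β (m + d) x =
      ∑ k ∈ Finset.range (2 * m + 1),
        rahPrefactor α β m d k * (∑ j ∈ Finset.range (m + 1), rahTerm α β m d k j) *
          jacobiP α β (k + d) x := by
  rw [jacobiP_mul_generic h (linConst_ne_zero h)]
  refine Finset.sum_congr rfl fun k hk => ?_
  rw [← rahPrefactor_eq h (by rw [Finset.mem_range] at hk; omega),
    Finset.sum_congr rfl fun j _ => rahSummand_eq h m d k j, ← Finset.mul_sum]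
  ring

lemma poch_ne_zero {t : ℝ} {j : ℕ} (ht : ∀ i < j, t + i ≠ 0) : poch t j ≠ 0 := by
  induction j with
  | zero => simp [poch_zero]
  | succ j ih =>
    rw [poch_succ]
    exact mul_ne_zero (ih fun i hi => ht i (by omega)) (ht j (by omega))

lemma poch_ne_zero_of_pos {t : ℝ} (ht : 0 < t) (j : ℕ) : poch t j ≠ 0 :=
  poch_ne_zero fun i _ => by positivity

lemma poch_ne_zero_of_ne_intCast {t : ℝ} (ht : ∀ z : ℤ, t ≠ z) (j : ℕ) : poch t j ≠ 0 :=
  poch_ne_zero fun i _ => by simpa using add_intCast_ne_zero ht i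

lemma poch_neg_half_mul_eq_zero {k j : ℕ} (hkj : k < 2 * j) :
    poch (-(k : ℝ) / 2) j * poch ((1 - (k : ℝ)) / 2) j = 0 := by
  obtain ⟨c, rfl | rfl⟩ := Nat.even_or_odd' k
  · rw [show -((2 * c : ℕ) : ℝ) / 2 = -(c : ℝ) by push_cast; ring, poch_neg_natCast,
      invFact_of_neg (by omega)]
    ring
  · rw [show (1 - ((2 * c + 1 : ℕ) : ℝ)) / 2 = -(c : ℝ) by push_cast; ring, poch_neg_natCast c,
      invFact_of_neg (by omega)]
    ring

lemma poch_mul_poch_half_div {t : ℝ} (ht : -(1 / 2) < t) {s : ℝ} (hs : t = 0 → s = 0) (j : ℕ) :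
    poch t j * poch (t / 2 + 1) j * poch s j / poch (t / 2) j = wellPoised t j * poch s j := by
  rcases j with _ | j
  · simp [poch_zero, wellPoised]
  rcases eq_or_ne t 0 with h0 | h0
  · rw [hs h0, poch_succ' 0]
    ring
  have h1 : poch (t / 2) (j + 1) ≠ 0 := poch_ne_zero fun i _ => by
    rcases i with _ | i
    · simpa using h0
    · push_cast
      have : (0 : ℝ) ≤ i := by positivity
      linarith
  have h2 := mul_wellPoised t (j + 1)
  have h3 : t * poch (t / 2 + 1) (j + 1) = poch (t / 2) (j + 1) * (t + 2 * (j + 1)) := by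
    have e1 := poch_succ (t / 2) (j + 1)
    have e2 := poch_succ' (t / 2) (j + 1)
    push_cast at e1
    linear_combination 2 * e1 - 2 * e2
  rw [div_eq_iff h1]
  refine mul_left_cancel₀ h0 ?_
  push_cast at h2
  linear_combination poch t (j + 1) * poch s (j + 1) * h3 -
    poch s (j + 1) * poch (t / 2) (j + 1) * h2

lemma pochZ_natCast (a : ℝ) (k : ℕ) : pochZ a k = poch a k := by simp [pochZ]

lemma ifact_natCast (k : ℕ) : ifact k = k.factorial := by simp [ifact]

lemma aRah_eq {α β : ℝ} (hβ : -1 < β) {m k : ℕ} (hk : k ≤ 2 * m) (d : ℕ) :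
    aRah α β k (m + d : ℕ) m =
      rahPrefactor α β m d k * ∑ j ∈ Finset.range (m + 1), rahTerm α β m d k j := by
  have e1 : 2 * ((m + d : ℕ) : ℤ) - 2 * m = ((2 * d : ℕ) : ℤ) := by push_cast; ring
  have e2 : 2 * (m : ℤ) = ((2 * m : ℕ) : ℤ) := by push_cast; ring
  have e3 : ((m + d : ℕ) : ℤ) - m = (d : ℤ) := by push_cast; ring
  have e4 : 2 * ((m + d : ℕ) : ℤ) = ((2 * (m + d) : ℕ) : ℤ) := by push_cast; ring
  rw [aRah, e1, e2, e3, e4, hypSum, tsum_eq_sum (s := Finset.range (m + 1)) fun j hj => ?_]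
  · simp only [pochZ_natCast, ifact_natCast]
    congr 1
    · rw [rahPrefactor]
      push_cast
      ring_nf
    · refine Finset.sum_congr rfl fun j _ => ?_
      have hd : (0 : ℝ) ≤ d := by positivity
      have key := poch_mul_poch_half_div (t := β + d + 1 / 2) (s := β + 1 / 2) (by linarith)
        (fun h => by
          rcases d with _ | d
          · simpa using h
          · push_cast at h
            have : (0 : ℝ) ≤ d := by positivity
            linarith) j
      rw [rahTerm, ← key]
      simp only [List.map_cons, List.map_nil, List.prod_cons, List.prod_nil]
      push_cast
      rw [show β + ((m : ℝ) + d) - m + 1 / 2 = β + d + 1 / 2 by ring,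
        show (β + ((m : ℝ) + d) - m + 5 / 2) / 2 = (β + d + 1 / 2) / 2 + 1 by ring,
        show (α + β + (k : ℝ) + 1) / 2 + ((m : ℝ) + d) - m = (α + β + k + 1) / 2 + d by ring,
        show (α + β + (k : ℝ) + 2) / 2 + ((m : ℝ) + d) - m = (α + β + k + 2) / 2 + d by ring,
        show (m : ℝ) + d - m + 1 = d + 1 by ring,
        show ((k : ℝ) + 2) / 2 + β + ((m : ℝ) + d) - m = (k + 2) / 2 + β + d by ring,
        show ((k : ℝ) + 3) / 2 + β + ((m : ℝ) + d) - m = (k + 3) / 2 + β + d by ring, one_pow]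
      simp only [div_eq_mul_inv, mul_inv]
      ring
  · rw [Finset.mem_range, not_lt] at hj
    have := poch_neg_half_mul_eq_zero (show k < 2 * j by omega)
    simp only [List.map_cons, List.map_nil, List.prod_cons, List.prod_nil]
    simp only [Int.cast_natCast]
    rcases mul_eq_zero.1 this with h | h <;>
      rw [h] <;> simp only [zero_mul, mul_zero, zero_div]

@[fun_prop]
lemma ContinuousAt.poch {X : Type*} [TopologicalSpace X] {f : X → ℝ} {x : X}
    (hf : ContinuousAt f x) (k : ℕ) : ContinuousAt (fun y => poch (f y) k) x :=
  (ascPochhammer ℝ k).continuous.continuousAt.comp hf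

@[fun_prop]
lemma ContinuousAt.wellPoised {X : Type*} [TopologicalSpace X] {f : X → ℝ} {x : X}
    (hf : ContinuousAt f x) (k : ℕ) : ContinuousAt (fun y => wellPoised (f y) k) x := by
  cases k with
  | zero => exact continuousAt_const
  | succ k =>
    simp only [_root_.wellPoised]
    fun_prop

lemma continuousAt_jacobiP {X : Type*} [TopologicalSpace X] {f g : X → ℝ} {y : X}
    (hf : ContinuousAt f y) (hg : ContinuousAt g y) (h : -1 < f y) (n : ℕ) (x : ℝ) :
    ContinuousAt (fun z => jacobiP (f z) (g z) n x) y := by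
  have h1 (j : ℕ) : _root_.poch (f y + 1) j * j.factorial ≠ 0 :=
    mul_ne_zero (poch_ne_zero_of_pos (by linarith) j) (by positivity)
  simp only [jacobiP]
  refine ContinuousAt.mul (by fun_prop) (tendsto_finsetSum _ fun j _ => ?_)
  exact ((show ContinuousAt _ y by fun_prop).div (by fun_prop) (h1 j)).mul continuousAt_const

lemma continuousAt_rahPrefactor {X : Type*} [TopologicalSpace X] {f g : X → ℝ} {y : X}
    (hf : ContinuousAt f y) (hg : ContinuousAt g y) (h : -1 < f y) (h' : -1 < g y)
    (hs : ∀ z : ℤ, f y + g y ≠ z) (m d k : ℕ) :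
    ContinuousAt (fun z => rahPrefactor (f z) (g z) m d k) y := by
  have hd : (0 : ℝ) ≤ d := by positivity
  have hm : (0 : ℝ) ≤ m := by positivity
  have ha : ∀ z : ℤ, f y + g y + 1 ≠ z := fun z e => hs (z - 1) (by push_cast; linarith)
  have hna : ∀ z : ℤ, -f y - g y - 2 * m ≠ z := fun z e =>
    hs (-z - 2 * m) (by push_cast; linarith)
  have ha0 : f y + g y + 1 ≠ 0 := by simpa using ha 0
  simp only [rahPrefactor]
  refine (ContinuousAt.div (by fun_prop) (by fun_prop) ?_).mul
    (ContinuousAt.div (by fun_prop) (by fun_prop) ?_)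
  · refine mul_ne_zero (mul_ne_zero (mul_ne_zero (mul_ne_zero (mul_ne_zero (by positivity) ?_) ?_)
      ?_) ?_) ha0
    · exact poch_ne_zero_of_ne_intCast ha m
    all_goals exact poch_ne_zero_of_pos (by linarith) _
  · refine mul_ne_zero (mul_ne_zero (mul_ne_zero (mul_ne_zero (by positivity) ?_) ?_) ?_) ?_
    on_goal 4 => exact poch_ne_zero_of_ne_intCast hna k
    all_goals exact poch_ne_zero_of_pos (by linarith) _

lemma continuousAt_rahTerm {X : Type*} [TopologicalSpace X] {f g : X → ℝ} {y : X}
    (hf : ContinuousAt f y) (hg : ContinuousAt g y) (h : -1 < f y) (h' : -1 < g y)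
    (hs : ∀ z : ℤ, f y - g y ≠ z) {m j : ℕ} (hj : j ≤ m) (d k : ℕ) :
    ContinuousAt (fun z => rahTerm (f z) (g z) m d k j) y := by
  have hd : (0 : ℝ) ≤ d := by positivity
  have hk : (0 : ℝ) ≤ k := by positivity
  simp only [rahTerm]
  refine ContinuousAt.div (by fun_prop) (by fun_prop) ?_
  refine mul_ne_zero (mul_ne_zero (mul_ne_zero (mul_ne_zero (mul_ne_zero (mul_ne_zero (mul_ne_zero
    ?_ ?_) ?_) ?_) ?_) ?_) ?_) (by positivity)
  · exact poch_ne_zero_of_pos (by linarith) j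
  · refine poch_ne_zero_of_ne_intCast (fun z e => half_ne_intCast (z + m) ?_) j
    push_cast
    linarith
  · refine poch_ne_zero fun i hi => ?_
    have : (1 : ℝ) ≤ m := by exact_mod_cast (show 1 ≤ m by omega)
    have : (0 : ℝ) ≤ i := by positivity
    linarith
  · refine poch_ne_zero fun i _ e => hs (2 * i - k + 1) ?_
    push_cast
    linarith
  · refine poch_ne_zero fun i _ e => hs (2 * i - k + 2) ?_
    push_cast
    linarith
  all_goals exact poch_ne_zero_of_pos (by linarith) j

lemma frequently_genericPair (α β : ℝ) :
    ∃ᶠ ε in nhds (0 : ℝ), GenericPair (α + ε) (β + 2 * ε) := by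
  have hc : (⋃ z : ℤ, ({(z : ℝ) / 2 - α, (z : ℝ) / 4 - β / 2, ((z : ℝ) / 2 - α - β) / 3,
      α - β - z} : Set ℝ)).Countable :=
    Set.countable_iUnion fun z => (Set.toFinite _).countable
  have hd := (hc.dense_compl ℝ) 0
  rw [mem_closure_iff_frequently] at hd
  refine hd.mono fun ε hε => ?_
  simp only [Set.mem_compl_iff, Set.mem_iUnion, Set.mem_insert_iff, Set.mem_singleton_iff,
    not_exists, not_or] at hε
  refine ⟨fun z e => (hε z).1 ?_, fun z e => (hε z).2.1 ?_, fun z e => (hε z).2.2.1 ?_,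
    fun z e => (hε z).2.2.2 ?_⟩ <;> linarith

theorem stmt11 (m n : ℕ) (hmn : m ≤ n) (α β : ℝ) (hα : -1 < α) (hβ : -1 < β)
    (hd : ∀ z : ℤ, α - β ≠ (z : ℝ)) (hs : ∀ z : ℤ, α + β ≠ (z : ℝ)) (x : ℝ) :
    jacobiP α β m x * jacobiP α β n x =
      ∑ k ∈ Finset.range (2 * m + 1),
        aRah α β (k : ℤ) (n : ℤ) (m : ℤ) * jacobiP α β (k + (n - m)) x := by
  obtain ⟨d, rfl⟩ := Nat.exists_eq_add_of_le hmn
  rw [Nat.add_sub_cancel_left, Finset.sum_congr rfl fun k hk => by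
    rw [aRah_eq hβ (by rw [Finset.mem_range] at hk; omega)]]
  have hf : ContinuousAt (fun ε : ℝ => α + ε) 0 := by fun_prop
  have hg : ContinuousAt (fun ε : ℝ => β + 2 * ε) 0 := by fun_prop
  have hf0 : -1 < α + (0 : ℝ) := by simpa using hα
  have hg0 : -1 < β + 2 * (0 : ℝ) := by simpa using hβ
  have hl := (continuousAt_jacobiP hf hg hf0 m x).mul (continuousAt_jacobiP hf hg hf0 (m + d) x)
  have hr : ContinuousAt (fun ε : ℝ => ∑ k ∈ Finset.range (2 * m + 1),
      rahPrefactor (α + ε) (β + 2 * ε) m d k *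
        (∑ j ∈ Finset.range (m + 1), rahTerm (α + ε) (β + 2 * ε) m d k j) *
          jacobiP (α + ε) (β + 2 * ε) (k + d) x) 0 := by
    refine tendsto_finsetSum _ fun k _ => ContinuousAt.mul (ContinuousAt.mul
      (continuousAt_rahPrefactor hf hg hf0 hg0 (by simpa using hs) m d k)
      (tendsto_finsetSum _ fun j hj => ?_)) (continuousAt_jacobiP hf hg hf0 (k + d) x)
    exact continuousAt_rahTerm hf hg hf0 hg0 (by simpa using hd)
      (by rw [Finset.mem_range] at hj; omega) d k
  by_contra hne
  refine frequently_genericPair α β ?_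
  filter_upwards [(hl.ne_iff_eventually_ne hr).1 (by simpa using hne)] with ε hε h
  exact hε (jacobiP_mul_eq_sum h m d x)
end
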